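/- arXiv:2305.18987 — 2 statements merged into one kernel-verified Lean document; each statement's English description precedes it below -/
import Mathlib

section
/- Assume n ≥ 50, α ≥ 4 and K > 0. For any ε ∈ (0,1) there exist a measurable test φ : ℝ^{p×n} → {0,1} and a constant C > 0 depending only on α, K and ε such that R_{P_{α,K}^⊗, multi}(ρ, φ) ≤ ε as long as ρ² ≥ C·√p·log(n). -/
open MeasureTheory
open scoped Classical

namespace ChangePoint

noncomputable section

/-- The `i`-th column (0-based) of the data matrix, with out-of-range guard. -/
def col (p n : ℕ) (X : Fin n → Fin p → ℝ) (i : ℕ) : Fin p → ℝ :=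
  if h : i < n then X ⟨i, h⟩ else 0

/-- ℓ₀-"norm": the number of nonzero coordinates. -/
def l0 (p : ℕ) (v : Fin p → ℝ) : ℕ :=
  (Finset.univ.filter fun j : Fin p => v j ≠ 0).card

/-- Squared Euclidean norm on `ℝ^p`. -/
def sqnorm (p : ℕ) (v : Fin p → ℝ) : ℝ := ∑ j, v j ^ 2

/-- The iterated logarithm `log log (8 n)`. -/
def LL (n : ℕ) : ℝ := Real.log (Real.log (8 * n))

/-- The sub-Weibull class `𝒢_{α,K}` of distributions on `ℝ`:
mean `0`, variance `1` and `𝔼 exp (|W/K|^α) ≤ 2`. -/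
def memG (α K : ℝ) (ν : Measure ℝ) : Prop :=
  IsProbabilityMeasure ν ∧ Integrable id ν ∧ (∫ x, x ∂ν) = 0 ∧
    (∫⁻ x, ENNReal.ofReal (x ^ 2) ∂ν) = 1 ∧
    (∫⁻ x, ENNReal.ofReal (Real.exp (|x / K| ^ α)) ∂ν) ≤ 2

/-- The polynomially-tailed class `𝒫_{α,K}` of distributions on `ℝ`:
mean `0`, variance `1` and `𝔼 |W/K|^α ≤ 1`. -/
def memP (α K : ℝ) (ν : Measure ℝ) : Prop :=
  IsProbabilityMeasure ν ∧ Integrable id ν ∧ (∫ x, x ∂ν) = 0 ∧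
    (∫⁻ x, ENNReal.ofReal (x ^ 2) ∂ν) = 1 ∧
    (∫⁻ x, ENNReal.ofReal (|x / K| ^ α) ∂ν) ≤ 1

/-- `P` is the joint law on `ℝ^{p×n}` of `p·n` independent entries with marginal laws `ν t j`
(characterised on measurable rectangles). -/
def IsEntrywiseProduct (p n : ℕ) (P : Measure (Fin n → Fin p → ℝ))
    (ν : Fin n → Fin p → Measure ℝ) : Prop :=
  IsProbabilityMeasure P ∧
    ∀ s : Fin n → Fin p → Set ℝ, (∀ t j, MeasurableSet (s t j)) →
      P {x | ∀ t j, x t j ∈ s t j} = ∏ t, ∏ j, ν t j (s t j)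

/-- The class `𝒢_{α,K}^⊗` of noise distributions. -/
def Gclass (p n : ℕ) (α K : ℝ) : Set (Measure (Fin n → Fin p → ℝ)) :=
  {P | ∃ ν : Fin n → Fin p → Measure ℝ, (∀ t j, memG α K (ν t j)) ∧ IsEntrywiseProduct p n P ν}

/-- The class `𝒫_{α,K}^⊗` of noise distributions. -/
def Pclass (p n : ℕ) (α K : ℝ) : Set (Measure (Fin n → Fin p → ℝ)) :=
  {P | ∃ ν : Fin n → Fin p → Measure ℝ, (∀ t j, memP α K (ν t j)) ∧ IsEntrywiseProduct p n P ν}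

/-- The null parameter space `Θ₀(p,n)`: constant signal. -/
def Theta0 (p n : ℕ) : Set (Fin n → Fin p → ℝ) :=
  {θ | ∃ μ : Fin p → ℝ, ∀ t, θ t = μ}

/-- `Θ^{(t₀)}(p,n,s,ρ)`: a single mean change at (1-based) time `t0` of sparsity `s` and
normalized signal strength at least `ρ`. -/
def ThetaAt (p n t0 s : ℕ) (ρ : ℝ) : Set (Fin n → Fin p → ℝ) :=
  {θ | ∃ μ₁ μ₂ : Fin p → ℝ,
    (∀ t : Fin n, (t : ℕ) < t0 → θ t = μ₁) ∧
    (∀ t : Fin n, t0 ≤ (t : ℕ) → θ t = μ₂) ∧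
    l0 p (fun j => μ₁ j - μ₂ j) ≤ s ∧
    ρ ^ 2 ≤ (t0 : ℝ) * ((n : ℝ) - (t0 : ℝ)) / (n : ℝ) * sqnorm p (fun j => μ₁ j - μ₂ j)}

/-- The single-change-point alternative `Θ(p,n,s,ρ)`. -/
def Theta1 (p n s : ℕ) (ρ : ℝ) : Set (Fin n → Fin p → ℝ) :=
  ⋃ t0 ∈ Finset.Icc 1 (n - 1), ThetaAt p n t0 s ρ

/-- A (randomized-free) test: a measurable `{0,1}`-valued function of the data. -/
def IsTest (p n : ℕ) (φ : (Fin n → Fin p → ℝ) → ℝ) : Prop :=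
  Measurable φ ∧ ∀ x, φ x = 0 ∨ φ x = 1

/-- The worst-case testing error of the test `φ` for null `Θ₀(p,n)` against the
alternative `Θalt`, over the noise class `Q`. -/
def risk (p n : ℕ) (Q : Set (Measure (Fin n → Fin p → ℝ)))
    (Θalt : Set (Fin n → Fin p → ℝ)) (φ : (Fin n → Fin p → ℝ) → ℝ) : ℝ :=
  (⨆ P ∈ Q, ⨆ θ ∈ Theta0 p n, ∫ E, φ (θ + E) ∂P) +
  (⨆ P ∈ Q, ⨆ θ ∈ Θalt, ∫ E, (1 - φ (θ + E)) ∂P)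

/-- The dyadic grid `𝒯 = {1,2,4,…,2^{⌊log₂(n/2)⌋}}`. -/
def Tgrid (n : ℕ) : Finset ℕ :=
  (Finset.range (Nat.log 2 (n / 2) + 1)).image fun k => 2 ^ k

/-- The CUSUM-type statistic `Y_t`. -/
def Yt (p n : ℕ) (X : Fin n → Fin p → ℝ) (t : ℕ) (j : Fin p) : ℝ :=
  (∑ i ∈ Finset.range t, (col p n X i j - col p n X (n - 1 - i) j)) / Real.sqrt (2 * t)

/-- `A_t = ∑_j (Y_t(j)² − 1)`. -/
def At (p n : ℕ) (X : Fin n → Fin p → ℝ) (t : ℕ) : ℝ :=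
  ∑ j, (Yt p n X t j ^ 2 - 1)

/-- The dense sub-Weibull test `φ_{𝒢,dense}` with threshold `r`. -/
def phiGdense (p n : ℕ) (r : ℝ) (X : Fin n → Fin p → ℝ) : ℝ :=
  if ∃ t ∈ Tgrid n, r < At p n X t then 1 else 0

/-- Sample-splitting statistic `Y_{t,1}` (odd-indexed observations). -/
def Yt1 (p n : ℕ) (X : Fin n → Fin p → ℝ) (t : ℕ) (j : Fin p) : ℝ :=
  (∑ i ∈ Finset.range (t / 2), (col p n X (2 * i) j - col p n X (n - 1 - 2 * i) j)) /
    Real.sqrt t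

/-- Sample-splitting statistic `Y_{t,2}` (even-indexed observations). -/
def Yt2 (p n : ℕ) (X : Fin n → Fin p → ℝ) (t : ℕ) (j : Fin p) : ℝ :=
  (∑ i ∈ Finset.range (t / 2), (col p n X (2 * i + 1) j - col p n X (n - 2 - 2 * i) j)) /
    Real.sqrt t

/-- `Y_1 = (X_1 − X_n)/√2`. -/
def Y1 (p n : ℕ) (X : Fin n → Fin p → ℝ) (j : Fin p) : ℝ :=
  (col p n X 0 j - col p n X (n - 1) j) / Real.sqrt 2

/-- The hard-thresholded statistic `A_{t,a}`. -/
def Ata (p n : ℕ) (X : Fin n → Fin p → ℝ) (t : ℕ) (a : ℝ) : ℝ :=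
  if t = 1 then ∑ j, (Y1 p n X j ^ 2 - 1) * (if a ≤ |Y1 p n X j| then 1 else 0)
  else ∑ j, (Yt1 p n X t j ^ 2 - 1) * (if a ≤ |Yt2 p n X t j| then 1 else 0)

/-- The sparse sub-Weibull test `φ_{𝒢,sparse}` with threshold parameters `a, r, r₁`. -/
def phiGsparse (p n : ℕ) (a r r₁ : ℝ) (X : Fin n → Fin p → ℝ) : ℝ :=
  if (∃ t ∈ Tgrid n, t ≠ 1 ∧ r < Ata p n X t a) ∨ r₁ < Ata p n X 1 a then 1 else 0

/-- The median of a list of reals: its `⌈m/2⌉`-th smallest element. -/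
def median (l : List ℝ) : ℝ :=
  (l.insertionSort (· ≤ ·)).getD ((l.length + 1) / 2 - 1) 0

/-- `Z_i = (X_i − X_{n+1−i})/√2` (0-based index `i`). -/
def Zb (p n : ℕ) (X : Fin n → Fin p → ℝ) (i : ℕ) (j : Fin p) : ℝ :=
  (col p n X i j - col p n X (n - 1 - i) j) / Real.sqrt 2

/-- Mean of the `g`-th (0-based) of `G` consecutive equal-size groups of `Z_1,…,Z_t`. -/
def groupMean (p n : ℕ) (X : Fin n → Fin p → ℝ) (t G g : ℕ) (j : Fin p) : ℝ :=
  (∑ i ∈ Finset.range (t / G), Zb p n X (g * (t / G) + i) j) / ((t / G : ℕ) : ℝ)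

/-- The median-of-means statistic `A_t^{MoM}` with `G` groups. -/
def AMoM (p n : ℕ) (X : Fin n → Fin p → ℝ) (t G : ℕ) : ℝ :=
  (t : ℝ) * median (List.ofFn fun g : Fin G =>
    ∑ j, (groupMean p n X t G (g : ℕ) j ^ 2 - (G : ℝ) / (t : ℝ)))

/-- `Δ = 2^{3+⌈log₂ log log (8n)⌉}`. -/
def DeltaDense (n : ℕ) : ℕ := 2 ^ (3 + (Int.ceil (Real.logb 2 (LL n))).toNat)

/-- The dense median-of-means test `φ_{𝒫,dense}`. -/
def phiPdense (p n : ℕ) (α C₁ : ℝ) (X : Fin n → Fin p → ℝ) : ℝ :=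
  if ∃ t ∈ Tgrid n,
      1 < AMoM p n X t (min t (DeltaDense n)) /
        (C₁ * (p : ℝ) ^ max ((1 : ℝ) / 2) (2 / α) * ((min t (DeltaDense n) : ℕ) : ℝ))
  then 1 else 0

/-- `Δ = 2^{4+⌈log₂ log log (8n)⌉}`. -/
def DeltaSparse (n : ℕ) : ℕ := 2 ^ (4 + (Int.ceil (Real.logb 2 (LL n))).toNat)

/-- Mean of the `g`-th (0-based) of `G` consecutive equal-size groups of the odd-indexed
`Z_1, Z_3, …, Z_{t−1}`. -/
def groupMeanOdd (p n : ℕ) (X : Fin n → Fin p → ℝ) (t G g : ℕ) (j : Fin p) : ℝ :=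
  (∑ i ∈ Finset.range (t / (2 * G)), Zb p n X (2 * (g * (t / (2 * G)) + i)) j) /
    ((t / (2 * G) : ℕ) : ℝ)

/-- The hard-thresholded median-of-means statistic `A_{t,a}^{MoM}` with `G` groups. -/
def AMoMa (p n : ℕ) (X : Fin n → Fin p → ℝ) (t G : ℕ) (a : ℝ) : ℝ :=
  if t = 1 then ∑ j, (Zb p n X 0 j ^ 2 - 1) * (if a ≤ |Zb p n X 0 j| then 1 else 0)
  else ((t : ℝ) / 2) * median (List.ofFn fun g : Fin G =>
    ∑ j, (groupMeanOdd p n X t G (g : ℕ) j ^ 2 - 2 * (G : ℝ) / (t : ℝ)) *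
      (if a ≤ |Yt2 p n X t j| then 1 else 0))

/-- The sparse median-of-means test `φ_{𝒫,sparse}^{MoM}`. -/
def phiPsparseMoM (p n s : ℕ) (α C₁ C₂ : ℝ) (X : Fin n → Fin p → ℝ) : ℝ :=
  if ∃ t ∈ Tgrid n,
      1 < AMoMa p n X t (min t (DeltaSparse n) / 2)
            (C₁ * (((p : ℝ) / (s : ℝ)) ^ ((1 : ℝ) / α) +
              ((s : ℝ) ^ (-(1 : ℝ) / 2)) * Real.sqrt (LL n))) /
          (C₂ * (if t = 1 then (s : ℝ) * ((p : ℝ) / (s : ℝ)) ^ ((2 : ℝ) / α)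
                 else Real.sqrt (s : ℝ) * ((min t (DeltaSparse n) / 2 : ℕ) : ℝ)))
  then 1 else 0

/-- Condition RSM for `(α, K)` with constants `C₁, C₂`: statistical guarantee for a family
of (measurable) robust sparse mean estimators. -/
def CondRSM (p s : ℕ) (α K C₁ C₂ : ℝ)
    (est : (m : ℕ) → (Fin m → Fin p → ℝ) → ℝ → Fin p → ℝ) : Prop :=
  (∀ m : ℕ, Measurable fun Wη : (Fin m → Fin p → ℝ) × ℝ => est m Wη.1 Wη.2) ∧
  ∀ (m : ℕ) (μW : Fin p → ℝ) (ν : Fin m → Measure (Fin p → ℝ))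
    (P : Measure (Fin m → Fin p → ℝ)) (η : ℝ),
    0 < η → η < 1 → l0 p μW ≤ s →
    (∀ i, IsProbabilityMeasure (ν i)) →
    (∀ i j, Integrable (fun w => w j) (ν i) ∧ (∫ w, w j ∂ν i) = μW j) →
    (∀ i j k, Integrable (fun w => (w j - μW j) * (w k - μW k)) (ν i) ∧
      (∫ w, (w j - μW j) * (w k - μW k) ∂ν i) = if j = k then 1 else 0) →
    (∀ i j, (∫⁻ w, ENNReal.ofReal (|w j - μW j| ^ α) ∂ν i) ≤
      ENNReal.ofReal ((Real.sqrt 2 * K) ^ α)) →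
    IsProbabilityMeasure P →
    (∀ S : Fin m → Set (Fin p → ℝ), (∀ i, MeasurableSet (S i)) →
      P {W | ∀ i, W i ∈ S i} = ∏ i, ν i (S i)) →
    C₁ * ((s : ℝ) * Real.log (Real.exp 1 * (p : ℝ) / (s : ℝ)) + Real.log (1 / η)) ≤ (m : ℝ) →
    ENNReal.ofReal (1 - η) ≤
      P {W | Real.sqrt (sqnorm p fun j => est m W η j - μW j) ≤
        Real.sqrt C₂ * (Real.sqrt ((s : ℝ) * Real.log (Real.exp 1 * (p : ℝ) / (s : ℝ)) / (m : ℝ)) +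
          Real.sqrt (Real.log (1 / η) / (m : ℝ)))}

/-- `Δ̃₁ = C₅ (s log(ep/s) + log(16/ε))`. -/
def rsmDelta1 (p s : ℕ) (ε C₅ : ℝ) : ℝ :=
  C₅ * ((s : ℝ) * Real.log (Real.exp 1 * (p : ℝ) / (s : ℝ)) + Real.log (16 / ε))

/-- `Δ̃₂ = C₅ (s log(ep/s) + log(16 log(2n)/ε))`. -/
def rsmDelta2 (p s n : ℕ) (ε C₅ : ℝ) : ℝ :=
  C₅ * ((s : ℝ) * Real.log (Real.exp 1 * (p : ℝ) / (s : ℝ)) +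
    Real.log (16 * Real.log (2 * (n : ℝ)) / ε))

/-- `a = C₃ ((p/s)^{1/α} + s^{−1/2} log^{1/2}(log Δ̃₁))`. -/
def rsmA (p s : ℕ) (α ε C₃ C₅ : ℝ) : ℝ :=
  C₃ * (((p : ℝ) / (s : ℝ)) ^ ((1 : ℝ) / α) +
    ((s : ℝ) ^ (-(1 : ℝ) / 2)) * Real.sqrt (Real.log (Real.log (rsmDelta1 p s ε C₅))))

/-- The sparse test `φ^{RSM}_{𝒫,sparse}` built from a robust sparse mean estimator `est`. -/
def phiRSM (p n s : ℕ) (est : (m : ℕ) → (Fin m → Fin p → ℝ) → ℝ → Fin p → ℝ)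
    (α ε C₃ C₄ C₅ C₆ : ℝ) (X : Fin n → Fin p → ℝ) : ℝ :=
  if (∃ t ∈ Tgrid n, (t : ℝ) ≤ rsmDelta1 p s ε C₅ ∧
        1 < Ata p n X t (rsmA p s α ε C₃ C₅) /
          (C₄ * (if t = 1 then (s : ℝ) * ((p : ℝ) / (s : ℝ)) ^ ((2 : ℝ) / α)
                 else Real.sqrt ((s : ℝ) * Real.log (rsmDelta1 p s ε C₅))))) ∨
     (∃ t ∈ Tgrid n, rsmDelta1 p s ε C₅ < (t : ℝ) ∧
        1 < (t : ℝ) * sqnorm p (est t (fun i : Fin t => fun j => Zb p n X (i : ℕ) j)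
              (Real.exp ((s : ℝ) * Real.log (Real.exp 1 * (p : ℝ) / (s : ℝ)) -
                min (t : ℝ) (rsmDelta2 p s n ε C₅) / C₅))) /
          (C₆ * min (t : ℝ) (rsmDelta2 p s n ε C₅)))
  then 1 else 0

/-- The multiple-change-point alternative `Θ_multi(p,n,ρ)`. -/
def ThetaMulti (p n : ℕ) (ρ : ℝ) : Set (Fin n → Fin p → ℝ) :=
  {θ | ∃ k : ℕ, 1 ≤ k ∧ ∃ τ : ℕ → ℕ, ∃ μ : ℕ → Fin p → ℝ,
    τ 0 = 0 ∧ τ (k + 1) = n ∧ (∀ i ≤ k, τ i < τ (i + 1)) ∧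
    (∀ i, 1 ≤ i → i ≤ k + 1 →
      ∀ t : Fin n, τ (i - 1) ≤ (t : ℕ) → (t : ℕ) < τ i → θ t = μ i) ∧
    ∃ i, 1 ≤ i ∧ i ≤ k ∧
      4 * Real.log (n : ℝ) ≤ ((min (τ i - τ (i - 1)) (τ (i + 1) - τ i) : ℕ) : ℝ) ∧
      ρ ^ 2 ≤ sqnorm p (fun j => μ (i + 1) j - μ i j) *
        ((min (τ i - τ (i - 1)) (τ (i + 1) - τ i) : ℕ) : ℝ)}

/-- Membership in the temporal-dependence class `𝒫_Temp`: independent rows, entrywise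
`𝒫_{α,K}` marginals, and exponentially decaying interlaced α-mixing coefficients. -/
def memPTemp (p n : ℕ) (α K c₁ c₂ : ℝ) (P : Measure (Fin n → Fin p → ℝ)) : Prop :=
  IsProbabilityMeasure P ∧
  (∀ s : Fin p → Set (Fin n → ℝ), (∀ j, MeasurableSet (s j)) →
    P {x | ∀ j, (fun t => x t j) ∈ s j} = ∏ j, P {x | (fun t => x t j) ∈ s j}) ∧
  (∀ t j, memP α K (P.map fun x => x t j)) ∧
  (∀ i : ℕ, 1 ≤ i → i ≤ n - 1 →
    ∀ S T : Set (Fin n),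
      (∀ s' ∈ S, ∀ t' ∈ T, (i : ℤ) ≤ |((s' : ℕ) : ℤ) - ((t' : ℕ) : ℤ)|) →
      ∀ A B : Set (Fin n → Fin p → ℝ),
        MeasurableSet[MeasurableSpace.comap (fun x (t : S) => x t.1) inferInstance] A →
        MeasurableSet[MeasurableSpace.comap (fun x (t : T) => x t.1) inferInstance] B →
        |(P (A ∩ B)).toReal - (P A).toReal * (P B).toReal| ≤ c₁ * Real.exp (-c₂ * (i : ℝ)))

/-- The class `𝒲_α` of distributions on `ℝ^p`: centered with `𝔼|⟨W,v⟩|^α ≤ 1` for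
every unit vector `v`. -/
def memW (p : ℕ) (α : ℝ) (ν : Measure (Fin p → ℝ)) : Prop :=
  IsProbabilityMeasure ν ∧
  (∀ j, Integrable (fun w => w j) ν ∧ (∫ w, w j ∂ν) = 0) ∧
  ∀ v : Fin p → ℝ, sqnorm p v = 1 →
    (∫⁻ w, ENNReal.ofReal (|∑ j, w j * v j| ^ α) ∂ν) ≤ 1

/-- The class `𝒲_α^⊗`: independent columns with distributions in `𝒲_α`. -/
def Wclass (p n : ℕ) (α : ℝ) : Set (Measure (Fin n → Fin p → ℝ)) :=
  {P | ∃ ν : Fin n → Measure (Fin p → ℝ), (∀ t, memW p α (ν t)) ∧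
    IsProbabilityMeasure P ∧
    ∀ s : Fin n → Set (Fin p → ℝ), (∀ t, MeasurableSet (s t)) →
      P {x | ∀ t, x t ∈ s t} = ∏ t, ν t (s t)}

/-- The alternative `⋃_{t₀=1}^{n−1} Θ(p,n,ρ_{t₀})` for a location-dependent signal
strength sequence `ρ`. -/
def ThetaSeq (p n : ℕ) (ρ : ℕ → ℝ) : Set (Fin n → Fin p → ℝ) :=
  ⋃ t0 ∈ Finset.Icc 1 (n - 1),
    {θ | ∃ μ₁ μ₂ : Fin p → ℝ,
      (∀ t : Fin n, (t : ℕ) < t0 → θ t = μ₁) ∧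
      (∀ t : Fin n, t0 ≤ (t : ℕ) → θ t = μ₂) ∧
      (ρ t0) ^ 2 ≤ sqnorm p (fun j => μ₁ j - μ₂ j)}

/-- The boundary-restricted alternative `Θ_res(p,n,s,ρ)`. -/
def ThetaRes (p n s : ℕ) (ρ tres : ℝ) : Set (Fin n → Fin p → ℝ) :=
  {θ | ∃ t0 : ℕ, tres + 1 ≤ (t0 : ℝ) ∧ (t0 : ℝ) ≤ (n : ℝ) - tres ∧ θ ∈ ThetaAt p n t0 s ρ}

/-- `t^res = 32 (log (e² p / s) + s^{−1} log log (8n))`. -/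
def tRes (p n s : ℕ) : ℝ :=
  32 * (Real.log (Real.exp 1 ^ 2 * (p : ℝ) / (s : ℝ)) + LL n / (s : ℝ))

end

open ProbabilityTheory

/-- `F` depends only on the entries of the matrix whose indices satisfy `S`. -/
def DependsOnEntries {p n : ℕ} {β : Type*} (S : Fin n × Fin p → Prop)
    (F : (Fin n → Fin p → ℝ) → β) : Prop :=
  ∀ x y : Fin n → Fin p → ℝ, (∀ i, S i → x i.1 i.2 = y i.1 i.2) → F x = F y

/-- The law of a matrix with independent, centred, unit-variance entries. -/
structure IsWhiteNoise (p n : ℕ) (P : Measure (Fin n → Fin p → ℝ)) : Prop where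
  prob : IsProbabilityMeasure P
  indep : iIndepFun (fun (i : Fin n × Fin p) (x : Fin n → Fin p → ℝ) => x i.1 i.2) P
  memLp : ∀ t j, MemLp (fun x : Fin n → Fin p → ℝ => x t j) 2 P
  mean : ∀ t j, ∫ x, x t j ∂P = 0
  var : ∀ t j, Var[fun x : Fin n → Fin p → ℝ => x t j; P] = 1

theorem isWhiteNoise_of_mem_Pclass {p n : ℕ} {α K : ℝ} {P : Measure (Fin n → Fin p → ℝ)}
    (hP : P ∈ Pclass p n α K) : IsWhiteNoise p n P := by
  obtain ⟨ν, hν, hP1, hrect⟩ := hP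
  have hprob : ∀ t j, IsProbabilityMeasure (ν t j) := fun t j => (hν t j).1
  have hmeas : ∀ t j, Measurable fun x : Fin n → Fin p → ℝ => x t j := fun t j => by fun_prop
  have hmarg : ∀ t j, P.map (fun x : Fin n → Fin p → ℝ => x t j) = ν t j := by
    intro t j
    ext s hs
    rw [Measure.map_apply (by fun_prop) hs]
    have h := hrect (fun t' j' => if t' = t ∧ j' = j then s else Set.univ) (by
      intro t' j'; split_ifs <;> [exact hs; exact MeasurableSet.univ])
    have hset : {x : Fin n → Fin p → ℝ | ∀ t' j', x t' j' ∈
        (if t' = t ∧ j' = j then s else Set.univ)} = (fun x => x t j) ⁻¹' s := by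
      ext x
      simp only [Set.mem_ofPred_eq, Set.mem_preimage]
      refine ⟨fun hx => by simpa using hx t j, fun hx t' j' => ?_⟩
      split_ifs with h
      · rw [h.1, h.2]; exact hx
      · trivial
    rw [hset] at h
    rw [h, Finset.prod_eq_single t, Finset.prod_eq_single j]
    · simp
    · intro j' _ hj'; simp [hj']
    · simp
    · intro t' _ ht'; simp [ht']
    · simp
  have hmem : ∀ t j, MemLp (fun x : ℝ => x) 2 (ν t j) := by
    intro t j
    rw [memLp_two_iff_integrable_sq (by fun_prop)]
    refine ⟨by fun_prop, ?_⟩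
    rw [hasFiniteIntegral_iff_ofReal (ae_of_all _ fun x => sq_nonneg x), (hν t j).2.2.2.1]
    exact ENNReal.one_lt_top
  have hmean : ∀ t j, ∫ x, x t j ∂P = 0 := by
    intro t j
    rw [← (hν t j).2.2.1, ← hmarg t j, integral_map (hmeas t j).aemeasurable (by fun_prop)]
  have hmemP : ∀ t j, MemLp (fun x : Fin n → Fin p → ℝ => x t j) 2 P := by
    intro t j
    have := hmem t j
    rw [← hmarg t j, memLp_map_measure_iff (by fun_prop) (hmeas t j).aemeasurable] at this
    exact this
  refine ⟨hP1, ?_, hmemP, hmean, ?_⟩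
  · rw [iIndepFun_iff_measure_inter_preimage_eq_mul]
    intro S sets hsets
    have h := hrect (fun t j => if (t, j) ∈ S then sets (t, j) else Set.univ) (by
      intro t j; split_ifs with h <;> [exact hsets _ h; exact MeasurableSet.univ])
    have hset : {x : Fin n → Fin p → ℝ | ∀ t j, x t j ∈
        (if (t, j) ∈ S then sets (t, j) else Set.univ)} =
        ⋂ i ∈ S, (fun x : Fin n → Fin p → ℝ => x i.1 i.2) ⁻¹' sets i := by
      ext x
      simp only [Set.mem_ofPred_eq, Set.mem_iInter, Set.mem_preimage]
      refine ⟨fun hx i hi => by simpa [hi] using hx i.1 i.2, fun hx t j => ?_⟩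
      split_ifs with h
      · exact hx _ h
      · trivial
    rw [← hset, h, ← Fintype.prod_prod_type'
      (f := fun t j => ν t j (if (t, j) ∈ S then sets (t, j) else Set.univ)),
      ← Finset.prod_subset (Finset.subset_univ S)]
    · refine Finset.prod_congr rfl fun i hi => ?_
      rw [← hmarg i.1 i.2, Measure.map_apply (by fun_prop) (by simpa [hi] using hsets i hi)]
      simp [hi]
    · intro i _ hi
      simp [hi]
  · intro t j
    have hint : ∫ x, x ^ 2 ∂(ν t j) = 1 := by
      rw [integral_eq_lintegral_of_nonneg_ae (ae_of_all _ fun x => sq_nonneg x) (by fun_prop),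
        (hν t j).2.2.2.1]
      simp
    rw [variance_eq_sub (hmemP t j), hmean t j, ← hint, ← hmarg t j,
      integral_map (hmeas t j).aemeasurable (by fun_prop)]
    simp

theorem DependsOnEntries.eq_comp_restrict {p n : ℕ} {β : Type*} {F : (Fin n → Fin p → ℝ) → β}
    {U : Finset (Fin n × Fin p)} (hF : DependsOnEntries (· ∈ U) F) :
    F = (fun f : U → ℝ => F fun t j => if h : (t, j) ∈ U then f ⟨(t, j), h⟩ else 0) ∘
      fun x i => x i.1.1 i.1.2 := by
  ext1 x
  refine hF _ _ fun i hi => ?_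
  simp [hi]

theorem IsWhiteNoise.indepFun {p n : ℕ} {P : Measure (Fin n → Fin p → ℝ)}
    (hP : IsWhiteNoise p n P) {β γ : Type*} [MeasurableSpace β] [MeasurableSpace γ]
    {F : (Fin n → Fin p → ℝ) → β} {G : (Fin n → Fin p → ℝ) → γ}
    (hF : Measurable F) (hG : Measurable G) {S T : Fin n × Fin p → Prop}
    (hFS : DependsOnEntries S F) (hGT : DependsOnEntries T G) (hST : ∀ i, S i → ¬ T i) :
    IndepFun F G P := by
  have hmeas : ∀ U : Finset (Fin n × Fin p), Measurable fun f : U → ℝ =>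
      fun (t : Fin n) (j : Fin p) => if h : (t, j) ∈ U then f ⟨(t, j), h⟩ else 0 := by
    intro U
    refine measurable_pi_lambda _ fun t => measurable_pi_lambda _ fun j => ?_
    split_ifs
    · fun_prop
    · fun_prop
  have h := hP.indep.indepFun_finset (Finset.univ.filter S) (Finset.univ.filter T)
    (Finset.disjoint_filter.2 fun i _ => hST i) (fun i => by fun_prop)
  have hF' : DependsOnEntries (· ∈ Finset.univ.filter S) F := fun x y hxy =>
    hFS x y fun i hi => hxy i (by simp [hi])
  have hG' : DependsOnEntries (· ∈ Finset.univ.filter T) G := fun x y hxy =>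
    hGT x y fun i hi => hxy i (by simp [hi])
  rw [hF'.eq_comp_restrict, hG'.eq_comp_restrict]
  exact h.comp (hF.comp (hmeas _)) (hG.comp (hmeas _))

theorem IsWhiteNoise.measure_biInter_le {p n : ℕ} {P : Measure (Fin n → Fin p → ℝ)}
    (hP : IsWhiteNoise p n P) {κ : Type*} (l : Fin n × Fin p → κ)
    (B : κ → Set (Fin n → Fin p → ℝ)) (hB : ∀ k, MeasurableSet (B k))
    (hBl : ∀ k, DependsOnEntries (fun i => l i = k) (· ∈ B k)) (η : ENNReal)
    (A : Finset κ) (hη : ∀ k ∈ A, P (B k) ≤ η) :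
    P (⋂ k ∈ A, B k) ≤ η ^ A.card := by
  have := hP.prob
  induction A using Finset.induction_on with
  | empty => simp
  | insert a s ha ih =>
    have hm : MeasurableSet (⋂ k ∈ s, B k) := Finset.measurableSet_biInter s fun k _ => hB k
    have hind : IndepFun (· ∈ B a) (· ∈ ⋂ k ∈ s, B k) P := by
      refine hP.indepFun (measurable_mem.2 (hB a)) (measurable_mem.2 hm) (hBl a)
        (T := fun i => l i ∈ s) ?_ (fun i hi hi' => ha (hi ▸ hi'))
      intro x y hxy
      simp only [Set.mem_iInter]
      refine propext (forall₂_congr fun k hk => ?_)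
      exact iff_of_eq (hBl k x y fun i hi => hxy i ((congrArg (· ∈ s) hi).mpr hk))
    have h := hind.measure_inter_preimage_eq_mul {True} {True} (measurableSet_singleton _)
      (measurableSet_singleton _)
    have e : ∀ C : Set (Fin n → Fin p → ℝ), (· ∈ C) ⁻¹' {True} = C := by
      intro C; ext x; simp
    rw [e, e] at h
    rw [Finset.set_biInter_insert, h, Finset.card_insert_of_notMem ha, pow_succ']
    exact mul_le_mul' (hη a (Finset.mem_insert_self _ _))
      (ih fun k hk => hη k (Finset.mem_insert_of_mem hk))

theorem IsWhiteNoise.measure_majority_le {p n : ℕ} {P : Measure (Fin n → Fin p → ℝ)}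
    (hP : IsWhiteNoise p n P) (l : Fin n × Fin p → ℕ)
    (B : ℕ → Set (Fin n → Fin p → ℝ)) (hB : ∀ k, MeasurableSet (B k))
    (hBl : ∀ k, DependsOnEntries (fun i => l i = k) (· ∈ B k)) (G : ℕ) {s : ℝ}
    (hs0 : 0 ≤ s) (hs1 : s ≤ 1) (hη : ∀ k < G, P (B k) ≤ ENNReal.ofReal (s ^ 2)) :
    P {x | G ≤ 2 * ((Finset.range G).filter fun k => x ∈ B k).card} ≤
      ENNReal.ofReal ((2 * s) ^ G) := by
  calc P {x | G ≤ 2 * ((Finset.range G).filter fun k => x ∈ B k).card}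
      ≤ P (⋃ A ∈ (Finset.range G).powerset.filter (fun A => G ≤ 2 * A.card),
          ⋂ k ∈ A, B k) := by
        refine measure_mono fun x hx => ?_
        simp only [Set.mem_iUnion, Set.mem_iInter]
        exact ⟨(Finset.range G).filter fun k => x ∈ B k,
          Finset.mem_filter.2 ⟨Finset.mem_powerset.2 (Finset.filter_subset _ _), hx⟩,
          fun k hk => (Finset.mem_filter.1 hk).2⟩
    _ ≤ ∑ A ∈ (Finset.range G).powerset.filter (fun A => G ≤ 2 * A.card),
          P (⋂ k ∈ A, B k) := measure_biUnion_finset_le _ _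
    _ ≤ ∑ A ∈ (Finset.range G).powerset.filter (fun A => G ≤ 2 * A.card),
          ENNReal.ofReal (s ^ G) := by
        refine Finset.sum_le_sum fun A hA => ?_
        rw [Finset.mem_filter, Finset.mem_powerset] at hA
        refine (hP.measure_biInter_le l B hB hBl _ A
          fun k hk => hη k (Finset.mem_range.1 (hA.1 hk))).trans ?_
        rw [← ENNReal.ofReal_pow (by positivity), ← pow_mul]
        exact ENNReal.ofReal_le_ofReal (pow_le_pow_of_le_one hs0 hs1 hA.2)
    _ ≤ ∑ A ∈ (Finset.range G).powerset, ENNReal.ofReal (s ^ G) :=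
        Finset.sum_le_sum_of_subset (Finset.filter_subset _ _)
    _ = ENNReal.ofReal ((2 * s) ^ G) := by
        rw [Finset.sum_const, Finset.card_powerset, Finset.card_range, mul_pow,
          ENNReal.ofReal_mul (by positivity), nsmul_eq_mul]
        congr 1
        rw [ENNReal.ofReal_pow (by norm_num)]
        simp

/-- The linear contrast of the columns of `X` with weights `a`. -/
noncomputable def contrast {p n : ℕ} (a : Fin n → ℝ) (X : Fin n → Fin p → ℝ) (j : Fin p) : ℝ :=
  ∑ t, a t * X t j

/-- The inner product of two contrasts. -/
noncomputable def crossStat {p n : ℕ} (a b : Fin n → ℝ) (X : Fin n → Fin p → ℝ) : ℝ :=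
  ∑ j, contrast a X j * contrast b X j

@[fun_prop]
theorem measurable_contrast {p n : ℕ} (a : Fin n → ℝ) (j : Fin p) :
    Measurable fun X : Fin n → Fin p → ℝ => contrast a X j := by
  unfold contrast
  fun_prop

@[fun_prop]
theorem measurable_crossStat {p n : ℕ} (a b : Fin n → ℝ) :
    Measurable fun X : Fin n → Fin p → ℝ => crossStat a b X := by
  unfold crossStat
  fun_prop

theorem contrast_add {p n : ℕ} (a : Fin n → ℝ) (X Y : Fin n → Fin p → ℝ) (j : Fin p) :
    contrast a (X + Y) j = contrast a X j + contrast a Y j := by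
  simp [contrast, mul_add, Finset.sum_add_distrib]

theorem dependsOnEntries_contrast {p n : ℕ} (a : Fin n → ℝ) (θ : Fin n → Fin p → ℝ) (j : Fin p) :
    DependsOnEntries (fun i => a i.1 ≠ 0 ∧ i.2 = j) fun X => contrast a (θ + X) j := by
  intro x y hxy
  refine Finset.sum_congr rfl fun t _ => ?_
  by_cases h : a t = 0
  · simp [h]
  · simp [hxy (t, j) ⟨h, rfl⟩]

theorem dependsOnEntries_crossStat {p n : ℕ} (a b : Fin n → ℝ) (θ : Fin n → Fin p → ℝ) :
    DependsOnEntries (fun i : Fin n × Fin p => a i.1 ≠ 0 ∨ b i.1 ≠ 0)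
      fun X => crossStat a b (θ + X) := by
  intro x y hxy
  refine Finset.sum_congr rfl fun j _ => ?_
  exact congrArg₂ (· * ·)
    (dependsOnEntries_contrast a θ j x y fun i hi => hxy i (Or.inl hi.1))
    (dependsOnEntries_contrast b θ j x y fun i hi => hxy i (Or.inr hi.1))

theorem IsWhiteNoise.memLp_contrast {p n : ℕ} {P : Measure (Fin n → Fin p → ℝ)}
    (hP : IsWhiteNoise p n P) (a : Fin n → ℝ) (θ : Fin n → Fin p → ℝ) (j : Fin p) :
    MemLp (fun E => contrast a (θ + E) j) 2 P := by
  have := hP.prob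
  simp only [contrast_add]
  have h : MemLp (fun E : Fin n → Fin p → ℝ => contrast a E j) 2 P :=
    memLp_finsetSum Finset.univ fun t _ => (hP.memLp t j).const_mul (a t)
  exact (memLp_const (contrast a θ j)).add h

theorem IsWhiteNoise.integral_contrast {p n : ℕ} {P : Measure (Fin n → Fin p → ℝ)}
    (hP : IsWhiteNoise p n P) (a : Fin n → ℝ) (θ : Fin n → Fin p → ℝ) (j : Fin p) :
    ∫ E, contrast a (θ + E) j ∂P = contrast a θ j := by
  have := hP.prob
  have hint : ∀ t ∈ Finset.univ, Integrable (fun E : Fin n → Fin p → ℝ => a t * E t j) P :=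
    fun t _ => ((hP.memLp t j).integrable one_le_two).const_mul _
  simp only [contrast_add]
  rw [integral_add (integrable_const _) (by unfold contrast; exact integrable_finsetSum _ hint)]
  unfold contrast
  rw [integral_finsetSum _ hint]
  simp [integral_const_mul, hP.mean]

theorem IsWhiteNoise.variance_contrast {p n : ℕ} {P : Measure (Fin n → Fin p → ℝ)}
    (hP : IsWhiteNoise p n P) (a : Fin n → ℝ) (θ : Fin n → Fin p → ℝ) (j : Fin p) :
    Var[fun E => contrast a (θ + E) j; P] = ∑ t, a t ^ 2 := by
  have := hP.prob
  simp only [contrast_add]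
  rw [variance_const_add (by fun_prop)]
  have h := IndepFun.variance_sum (μ := P) (s := Finset.univ)
    (X := fun t (E : Fin n → Fin p → ℝ) => a t * E t j)
    (fun t _ => (hP.memLp t j).const_mul (a t)) (by
      intro t _ t' _ htt'
      have := hP.indep.indepFun (i := (t, j)) (j := (t', j)) (by simpa using htt')
      exact this.comp (measurable_const_mul (a t)) (measurable_const_mul (a t')))
  have e : (fun E : Fin n → Fin p → ℝ => contrast a E j) =
      ∑ t, fun E : Fin n → Fin p → ℝ => a t * E t j := by
    ext E; simp [contrast]
  rw [e, h]
  simp [variance_const_mul, hP.var]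

theorem IsWhiteNoise.integral_contrast_sq {p n : ℕ} {P : Measure (Fin n → Fin p → ℝ)}
    (hP : IsWhiteNoise p n P) (a : Fin n → ℝ) (θ : Fin n → Fin p → ℝ) (j : Fin p) :
    ∫ E, contrast a (θ + E) j ^ 2 ∂P = ∑ t, a t ^ 2 + contrast a θ j ^ 2 := by
  have := hP.prob
  have h := variance_eq_sub (hP.memLp_contrast a θ j)
  rw [hP.variance_contrast, hP.integral_contrast] at h
  simp only [Pi.pow_apply] at h
  linarith

/-- Chebyshev's inequality for the cross statistic of two contrasts with disjoint supports. -/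
theorem IsWhiteNoise.measure_crossStat_deviation_le {p n : ℕ} {P : Measure (Fin n → Fin p → ℝ)}
    (hP : IsWhiteNoise p n P) {a b : Fin n → ℝ} (hab : ∀ t, a t = 0 ∨ b t = 0) {v : ℝ}
    (ha : ∑ t, a t ^ 2 = v) (hb : ∑ t, b t ^ 2 = v) {θ : Fin n → Fin p → ℝ} {δ : Fin p → ℝ}
    (haθ : contrast a θ = δ) (hbθ : contrast b θ = δ) {s : ℝ} (hs : 0 < s) :
    P {E | s ≤ |crossStat a b (θ + E) - sqnorm p δ|} ≤
      ENNReal.ofReal ((2 * v * sqnorm p δ + p * v ^ 2) / s ^ 2) := by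
  have := hP.prob
  have hsupp : ∀ j j' : Fin p, ∀ i : Fin n × Fin p, (a i.1 ≠ 0 ∧ i.2 = j) →
      ¬ (b i.1 ≠ 0 ∧ i.2 = j') := fun j j' i hi hi' => (hab i.1).elim hi.1 hi'.1
  have hma : ∀ j, Measurable fun E : Fin n → Fin p → ℝ => contrast a (θ + E) j :=
    fun j => (measurable_contrast a j).comp (measurable_const_add θ)
  have hmb : ∀ j, Measurable fun E : Fin n → Fin p → ℝ => contrast b (θ + E) j :=
    fun j => (measurable_contrast b j).comp (measurable_const_add θ)
  have hind : ∀ j, IndepFun (fun E => contrast a (θ + E) j) (fun E => contrast b (θ + E) j) P :=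
    fun j => hP.indepFun (hma j) (hmb j) (dependsOnEntries_contrast a θ j)
      (dependsOnEntries_contrast b θ j) (hsupp j j)
  have hindsq : ∀ j, IndepFun (fun E => contrast a (θ + E) j ^ 2)
      (fun E => contrast b (θ + E) j ^ 2) P := fun j =>
    (hind j).comp (measurable_id.pow_const 2) (measurable_id.pow_const 2)
  have hmem : ∀ j, MemLp (fun E => contrast a (θ + E) j * contrast b (θ + E) j) 2 P := by
    intro j
    refine (memLp_two_iff_integrable_sq ((hma j).mul (hmb j)).aestronglyMeasurable).2 ?_
    simp only [Pi.mul_apply, mul_pow]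
    exact (hindsq j).integrable_mul (hP.memLp_contrast a θ j).integrable_sq
      (hP.memLp_contrast b θ j).integrable_sq
  have hmean : ∀ j, ∫ E, contrast a (θ + E) j * contrast b (θ + E) j ∂P = δ j ^ 2 := by
    intro j
    have h := (hind j).integral_mul_eq_mul_integral (hma j).aestronglyMeasurable
      (hmb j).aestronglyMeasurable
    simp only [Pi.mul_apply] at h
    rw [h, hP.integral_contrast, hP.integral_contrast, haθ, hbθ, sq]
  have hvar : ∀ j, Var[fun E => contrast a (θ + E) j * contrast b (θ + E) j; P] =
      2 * v * δ j ^ 2 + v ^ 2 := by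
    intro j
    have h := (hindsq j).integral_mul_eq_mul_integral ((hma j).pow_const 2).aestronglyMeasurable
      ((hmb j).pow_const 2).aestronglyMeasurable
    simp only [Pi.mul_apply] at h
    rw [variance_eq_sub (hmem j), hmean j]
    simp only [Pi.pow_apply, mul_pow]
    rw [h, hP.integral_contrast_sq, hP.integral_contrast_sq, ha, hb, haθ, hbθ]
    ring
  have e : (fun E => crossStat a b (θ + E)) =
      ∑ j, fun E => contrast a (θ + E) j * contrast b (θ + E) j := by
    ext E; simp [crossStat]
  have hmemT : MemLp (fun E => crossStat a b (θ + E)) 2 P :=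
    memLp_finsetSum _ fun j _ => hmem j
  have hvarT : Var[fun E => crossStat a b (θ + E); P] = 2 * v * sqnorm p δ + p * v ^ 2 := by
    rw [e, IndepFun.variance_sum (fun j _ => hmem j)]
    · simp [hvar, Finset.sum_add_distrib, sqnorm, Finset.mul_sum]
    · intro j _ j' _ hjj'
      refine hP.indepFun (S := fun i => i.2 = j) (T := fun i => i.2 = j') ((hma j).mul (hmb j))
        ((hma j').mul (hmb j')) ?_ ?_ (fun i hi hi' => hjj' (hi.symm.trans hi'))
      all_goals
        intro x y hxy
        exact congrArg₂ (· * ·)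
          (dependsOnEntries_contrast a θ _ x y fun i hi => hxy i hi.2)
          (dependsOnEntries_contrast b θ _ x y fun i hi => hxy i hi.2)
  have hmeanT : ∫ E, crossStat a b (θ + E) ∂P = sqnorm p δ := by
    unfold crossStat
    rw [integral_finsetSum _ fun j _ => (hmem j).integrable one_le_two]
    simp [hmean, sqnorm]
  have h := meas_ge_le_variance_div_sq hmemT hs
  rwa [hmeanT, hvarT] at h

/-- The index of the block of length `m`, counted outwards from `t₀` on either side, containing
time `t`. -/
def blockIdx (t₀ m t : ℕ) : ℕ := if t₀ ≤ t then (t - t₀) / m else (t₀ - 1 - t) / m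

/-- The weights giving the difference between the mean of the `h`-th block of length `m` to the
right of `t₀` and the mean of the `h`-th block to its left. -/
noncomputable def blockWeight (n t₀ m h : ℕ) (t : Fin n) : ℝ :=
  if blockIdx t₀ m t = h then (if t₀ ≤ (t : ℕ) then (m : ℝ)⁻¹ else -(m : ℝ)⁻¹) else 0

theorem nat_div_eq_iff {a m h : ℕ} (hm : 0 < m) : a / m = h ↔ h * m ≤ a ∧ a < (h + 1) * m := by
  rw [← Nat.le_div_iff_mul_le hm, ← Nat.div_lt_iff_lt_mul hm]
  omega

theorem card_right_block {n t₀ m h : ℕ} (hm : 0 < m) (hn : t₀ + (h + 1) * m ≤ n) :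
    (Finset.univ.filter fun t : Fin n => blockIdx t₀ m t = h ∧ t₀ ≤ (t : ℕ)).card = m := by
  have e : (Finset.univ.filter fun t : Fin n => blockIdx t₀ m t = h ∧ t₀ ≤ (t : ℕ)).map
      Fin.valEmbedding = Finset.Ico (t₀ + h * m) (t₀ + (h + 1) * m) := by
    ext t
    simp only [Finset.mem_map, Finset.mem_filter, Finset.mem_univ, true_and,
      Fin.valEmbedding_apply, Finset.mem_Ico]
    constructor
    · rintro ⟨t, ⟨ht, htt⟩, rfl⟩
      rw [blockIdx, if_pos htt, nat_div_eq_iff hm] at ht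
      omega
    · rintro ⟨h1, h2⟩
      have htt : t₀ ≤ t := by omega
      refine ⟨⟨t, by omega⟩, ⟨?_, htt⟩, rfl⟩
      rw [blockIdx, if_pos htt, nat_div_eq_iff hm]
      exact ⟨by dsimp only; omega, by dsimp only; omega⟩
  rw [← Finset.card_map Fin.valEmbedding, e, Nat.card_Ico, add_mul]
  omega

theorem card_left_block {n t₀ m h : ℕ} (hm : 0 < m) (h0 : (h + 1) * m ≤ t₀) (hn : t₀ ≤ n) :
    (Finset.univ.filter fun t : Fin n => blockIdx t₀ m t = h ∧ ¬ t₀ ≤ (t : ℕ)).card = m := by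
  have e : (Finset.univ.filter fun t : Fin n => blockIdx t₀ m t = h ∧ ¬ t₀ ≤ (t : ℕ)).map
      Fin.valEmbedding = Finset.Ico (t₀ - (h + 1) * m) (t₀ - h * m) := by
    ext t
    simp only [Finset.mem_map, Finset.mem_filter, Finset.mem_univ, true_and,
      Fin.valEmbedding_apply, Finset.mem_Ico]
    constructor
    · rintro ⟨t, ⟨ht, htt⟩, rfl⟩
      rw [blockIdx, if_neg htt, nat_div_eq_iff hm] at ht
      omega
    · rintro ⟨h1, h2⟩
      have htt : ¬ t₀ ≤ t := by omega
      refine ⟨⟨t, by omega⟩, ⟨?_, htt⟩, rfl⟩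
      rw [blockIdx, if_neg htt, nat_div_eq_iff hm]
      exact ⟨by dsimp only; omega, by dsimp only; omega⟩
  rw [← Finset.card_map Fin.valEmbedding, e, Nat.card_Ico]
  rw [add_mul] at h0 ⊢
  omega

theorem sum_eq_of_block {n t₀ m h : ℕ} (hm : 0 < m) (h0 : (h + 1) * m ≤ t₀)
    (hn : t₀ + (h + 1) * m ≤ n) {F : Fin n → ℝ} {x y : ℝ}
    (hr : ∀ t : Fin n, blockIdx t₀ m t = h → t₀ ≤ (t : ℕ) → F t = x)
    (hl : ∀ t : Fin n, blockIdx t₀ m t = h → ¬ t₀ ≤ (t : ℕ) → F t = y)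
    (hz : ∀ t : Fin n, blockIdx t₀ m t ≠ h → F t = 0) :
    ∑ t, F t = m * x + m * y := by
  rw [← Finset.sum_filter_add_sum_filter_not Finset.univ (fun t : Fin n => blockIdx t₀ m t = h),
    Finset.sum_eq_zero (s := Finset.univ.filter fun t : Fin n => ¬ blockIdx t₀ m t = h)
      (fun t ht => hz t (Finset.mem_filter.1 ht).2),
    ← Finset.sum_filter_add_sum_filter_not _ (fun t : Fin n => t₀ ≤ (t : ℕ)),
    Finset.filter_filter, Finset.filter_filter,
    Finset.sum_eq_card_nsmul (b := x)
      (fun t ht => hr t (Finset.mem_filter.1 ht).2.1 (Finset.mem_filter.1 ht).2.2),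
    Finset.sum_eq_card_nsmul (b := y)
      (fun t ht => hl t (Finset.mem_filter.1 ht).2.1 (Finset.mem_filter.1 ht).2.2),
    card_right_block hm hn, card_left_block hm h0 (by omega)]
  simp

theorem sum_blockWeight_sq {n t₀ m h : ℕ} (hm : 0 < m) (h0 : (h + 1) * m ≤ t₀)
    (hn : t₀ + (h + 1) * m ≤ n) : ∑ t, blockWeight n t₀ m h t ^ 2 = 2 / m := by
  rw [sum_eq_of_block hm h0 hn (x := ((m : ℝ)⁻¹) ^ 2) (y := ((m : ℝ)⁻¹) ^ 2)]
  · have : (m : ℝ) ≠ 0 := by positivity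
    field_simp
    norm_num
  · intro t h1 h2; simp [blockWeight, h1, h2]
  · intro t h1 h2; simp [blockWeight, h1, h2]
  · intro t h1; simp [blockWeight, h1]

theorem contrast_blockWeight {p n t₀ m h D : ℕ} (hm : 0 < m) (hD : (h + 1) * m ≤ D)
    (h0 : D ≤ t₀) (hn : t₀ + D ≤ n) {θ : Fin n → Fin p → ℝ} {μ₁ μ₂ : Fin p → ℝ}
    (hθ₁ : ∀ t : Fin n, t₀ - D ≤ (t : ℕ) → (t : ℕ) < t₀ → θ t = μ₁)
    (hθ₂ : ∀ t : Fin n, t₀ ≤ (t : ℕ) → (t : ℕ) < t₀ + D → θ t = μ₂) :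
    contrast (blockWeight n t₀ m h) θ = fun j => μ₂ j - μ₁ j := by
  ext j
  rw [contrast, sum_eq_of_block hm (hD.trans h0) (by omega : t₀ + (h + 1) * m ≤ n)
    (x := (m : ℝ)⁻¹ * μ₂ j) (y := -(m : ℝ)⁻¹ * μ₁ j)]
  · have : (m : ℝ) ≠ 0 := by positivity
    field_simp
    ring
  · intro t h1 h2
    have h3 := h1
    rw [blockIdx, if_pos h2, nat_div_eq_iff hm] at h3
    simp [blockWeight, h1, h2, hθ₂ t h2 (by omega)]
  · intro t h1 h2
    have h3 := h1
    rw [blockIdx, if_neg h2, nat_div_eq_iff hm] at h3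
    simp [blockWeight, h1, h2, hθ₁ t (by omega) (by omega)]
  · intro t h1; simp [blockWeight, h1]

/-- The cross statistic of the two blocks with indices `2 g` and `2 g + 1` around `t₀`. -/
noncomputable def groupStat {p n : ℕ} (t₀ m g : ℕ) (X : Fin n → Fin p → ℝ) : ℝ :=
  crossStat (blockWeight n t₀ m (2 * g)) (blockWeight n t₀ m (2 * g + 1)) X

@[fun_prop]
theorem measurable_groupStat {p n : ℕ} (t₀ m g : ℕ) :
    Measurable fun X : Fin n → Fin p → ℝ => groupStat t₀ m g X := by
  unfold groupStat
  fun_prop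

theorem dependsOnEntries_groupStat {p n : ℕ} (t₀ m g : ℕ) (θ : Fin n → Fin p → ℝ) :
    DependsOnEntries (fun i : Fin n × Fin p => blockIdx t₀ m i.1 / 2 = g)
      fun X => groupStat t₀ m g (θ + X) := by
  intro x y hxy
  refine dependsOnEntries_crossStat _ _ θ x y fun i hi => hxy i ?_
  rcases hi with hi | hi
  all_goals
    unfold blockWeight at hi
    have := (ite_ne_right_iff.1 hi).1
    omega

theorem IsWhiteNoise.measure_groupStat_deviation_le {p n : ℕ}
    {P : Measure (Fin n → Fin p → ℝ)} (hP : IsWhiteNoise p n P) {t₀ m g D : ℕ} (hm : 0 < m)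
    (hD : 2 * (g + 1) * m ≤ D) (h0 : D ≤ t₀) (hn : t₀ + D ≤ n) {θ : Fin n → Fin p → ℝ}
    {μ₁ μ₂ : Fin p → ℝ} (hθ₁ : ∀ t : Fin n, t₀ - D ≤ (t : ℕ) → (t : ℕ) < t₀ → θ t = μ₁)
    (hθ₂ : ∀ t : Fin n, t₀ ≤ (t : ℕ) → (t : ℕ) < t₀ + D → θ t = μ₂) {s : ℝ} (hs : 0 < s) :
    P {E | s ≤ |groupStat t₀ m g (θ + E) - sqnorm p fun j => μ₂ j - μ₁ j|} ≤
      ENNReal.ofReal ((4 / m * sqnorm p (fun j => μ₂ j - μ₁ j) + 4 * p / m ^ 2) / s ^ 2) := by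
  have hD1 : (2 * g + 1 + 1) * m ≤ D := by convert hD using 1; ring
  have hD0 : (2 * g + 1) * m ≤ D := (Nat.mul_le_mul_right m (by omega)).trans hD1
  refine (hP.measure_crossStat_deviation_le ?_
    (sum_blockWeight_sq hm (hD0.trans h0) (by omega))
    (sum_blockWeight_sq hm (hD1.trans h0) (by omega))
    (contrast_blockWeight hm hD0 h0 hn hθ₁ hθ₂)
    (contrast_blockWeight hm hD1 h0 hn hθ₁ hθ₂) hs).trans_eq ?_
  · intro t
    by_cases h : blockIdx t₀ m t = 2 * g
    · right; rw [blockWeight, if_neg (by omega)]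
    · left; rw [blockWeight, if_neg h]
  · congr 2
    ring

/-- The data matrices for which at least half of the `G` group statistics around `t₀` exceed
`r`. -/
def majoritySet (p n G t₀ m : ℕ) (r : ℝ) : Set (Fin n → Fin p → ℝ) :=
  {X | G ≤ 2 * ((Finset.range G).filter fun g => r < groupStat t₀ m g X).card}

/-- The rejection region: some location `t₀` and block length `m` has a majority of large group
statistics. -/
def rejectionSet (p n G : ℕ) (c : ℝ) : Set (Fin n → Fin p → ℝ) :=
  ⋃ q ∈ (Finset.range n ×ˢ Finset.range n).filter
      fun q => 0 < q.2 ∧ 2 * G * q.2 ≤ q.1 ∧ q.1 + 2 * G * q.2 ≤ n,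
    majoritySet p n G q.1 q.2 (c * √p / q.2)

theorem measurableSet_majoritySet (p n G t₀ m : ℕ) (r : ℝ) :
    MeasurableSet (majoritySet p n G t₀ m r) := by
  unfold majoritySet
  simp only [Finset.card_filter]
  refine measurableSet_le measurable_const (measurable_const.mul ?_)
  refine Finset.measurable_sum _ fun g _ => Measurable.ite ?_ measurable_const measurable_const
  exact measurableSet_lt measurable_const (measurable_groupStat t₀ m g)

theorem measurableSet_rejectionSet (p n G : ℕ) (c : ℝ) :
    MeasurableSet (rejectionSet p n G c) :=
  Finset.measurableSet_biUnion _ fun _ _ => measurableSet_majoritySet _ _ _ _ _ _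

theorem IsWhiteNoise.measure_majoritySet_null_le {p n : ℕ} {P : Measure (Fin n → Fin p → ℝ)}
    (hP : IsWhiteNoise p n P) (hp : 0 < p) {G t₀ m : ℕ} (hm : 0 < m) (h0 : 2 * G * m ≤ t₀)
    (hn : t₀ + 2 * G * m ≤ n) {θ : Fin n → Fin p → ℝ} (hθ : θ ∈ Theta0 p n) {s c : ℝ}
    (hs0 : 0 ≤ s) (hs1 : s ≤ 1) (hc : 1 ≤ c) (hcs : 12 / c ≤ s ^ 2) :
    P {E | θ + E ∈ majoritySet p n G t₀ m (c * √p / m)} ≤ ENNReal.ofReal ((2 * s) ^ G) := by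
  obtain ⟨μ, hμ⟩ := hθ
  have hp' : (0 : ℝ) < p := by exact_mod_cast hp
  have hm' : (0 : ℝ) < m := by exact_mod_cast hm
  refine hP.measure_majority_le (fun i => blockIdx t₀ m i.1 / 2)
    (fun g => {E | c * √p / m < groupStat t₀ m g (θ + E)}) ?_ ?_ G hs0 hs1 ?_
  · exact fun g => measurableSet_lt measurable_const
      ((measurable_groupStat t₀ m g).comp (measurable_const_add θ))
  · exact fun g x y hxy => congrArg (c * √p / m < ·) (dependsOnEntries_groupStat t₀ m g θ x y hxy)
  · intro g hg
    have h := hP.measure_groupStat_deviation_le (g := g) (D := 2 * G * m) hm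
      (Nat.mul_le_mul_right m (by omega)) h0 hn (fun t _ _ => hμ t) (fun t _ _ => hμ t)
      (s := c * √p / m) (by positivity)
    have hz : sqnorm p (fun j => μ j - μ j) = 0 := by simp [sqnorm]
    rw [hz] at h
    refine (measure_mono fun E hE => ?_).trans (h.trans (ENNReal.ofReal_le_ofReal ?_))
    · rw [Set.mem_ofPred_eq, sub_zero]
      exact (le_of_lt hE).trans (le_abs_self _)
    · refine le_trans ?_ hcs
      rw [div_pow, mul_pow, Real.sq_sqrt hp'.le]
      have e : (4 / (m : ℝ) * 0 + 4 * p / (m : ℝ) ^ 2) / (c ^ 2 * p / (m : ℝ) ^ 2) = 4 / c ^ 2 := by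
        field_simp
        ring
      rw [e, div_le_div_iff₀ (by positivity) (by positivity)]
      nlinarith

theorem deviation_ratio_le {p m c q : ℝ} (hp : 1 ≤ p) (hm : 0 < m) (hc : 1 ≤ c)
    (hq : 2 * (c * √p) ≤ q * m) :
    (4 / m * q + 4 * p / m ^ 2) / (q / 2) ^ 2 ≤ 12 / c := by
  have hsp : 1 ≤ √p := Real.one_le_sqrt.2 hp
  have hsq : √p ^ 2 = p := Real.sq_sqrt (by linarith)
  have hcp : c ≤ c * √p := le_mul_of_one_le_right (by linarith) hsp
  have hqm : 0 < q * m := by nlinarith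
  have hq0 : 0 < q := pos_of_mul_pos_left hqm hm.le
  have e : (4 / m * q + 4 * p / m ^ 2) / (q / 2) ^ 2 = 16 / (q * m) + 16 * (√p / (q * m)) ^ 2 := by
    rw [div_pow √p, hsq]
    field_simp
    ring
  have h1 : 16 / (q * m) ≤ 8 / c := by
    rw [div_le_div_iff₀ hqm (by linarith)]
    linarith
  have h2 : √p / (q * m) ≤ 1 / (2 * c) := by
    rw [div_le_div_iff₀ hqm (by linarith)]
    linarith
  have h3 : (√p / (q * m)) ^ 2 ≤ (1 / (2 * c)) ^ 2 := by gcongr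
  have h4 : 16 * (1 / (2 * c)) ^ 2 ≤ 4 / c := by
    have : 16 * (1 / (2 * c)) ^ 2 = 4 / c * (1 / c) := by field_simp; norm_num
    rw [this]
    exact mul_le_of_le_one_right (by positivity) (by rw [div_le_one (by linarith)]; exact hc)
  have h5 : 12 / c = 8 / c + 4 / c := by ring
  rw [e, h5]
  linarith

theorem IsWhiteNoise.measure_majoritySet_compl_le {p n : ℕ} {P : Measure (Fin n → Fin p → ℝ)}
    (hP : IsWhiteNoise p n P) (hp : 0 < p) {G t₀ m D : ℕ} (hm : 0 < m) (hGD : 2 * G * m ≤ D)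
    (h0 : D ≤ t₀) (hn : t₀ + D ≤ n) {θ : Fin n → Fin p → ℝ} {μ₁ μ₂ : Fin p → ℝ}
    (hθ₁ : ∀ t : Fin n, t₀ - D ≤ (t : ℕ) → (t : ℕ) < t₀ → θ t = μ₁)
    (hθ₂ : ∀ t : Fin n, t₀ ≤ (t : ℕ) → (t : ℕ) < t₀ + D → θ t = μ₂) {s c : ℝ}
    (hs0 : 0 ≤ s) (hs1 : s ≤ 1) (hc : 1 ≤ c) (hcs : 12 / c ≤ s ^ 2)
    (hsig : 2 * (c * √p) ≤ sqnorm p (fun j => μ₂ j - μ₁ j) * m) :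
    P {E | θ + E ∉ majoritySet p n G t₀ m (c * √p / m)} ≤ ENNReal.ofReal ((2 * s) ^ G) := by
  have hp' : (1 : ℝ) ≤ p := by exact_mod_cast hp
  have hm' : (0 : ℝ) < m := by exact_mod_cast hm
  have hq0 : 0 < sqnorm p (fun j => μ₂ j - μ₁ j) :=
    pos_of_mul_pos_left ((by positivity : 0 < 2 * (c * √(p : ℝ))).trans_le hsig) hm'.le
  have hr : c * √p / m ≤ sqnorm p (fun j => μ₂ j - μ₁ j) / 2 := by
    rw [div_le_iff₀ hm']
    linarith
  refine le_trans (measure_mono ?_) (hP.measure_majority_le (fun i => blockIdx t₀ m i.1 / 2)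
    (fun g => {E | groupStat t₀ m g (θ + E) ≤ c * √p / m}) ?_ ?_ G hs0 hs1 ?_)
  · intro E hE
    rw [Set.mem_ofPred_eq, majoritySet, Set.mem_ofPred_eq] at hE
    have h := Finset.card_filter_add_card_filter_not (s := Finset.range G)
      (fun g => c * √p / m < groupStat t₀ m g (θ + E))
    simp only [not_lt, Finset.card_range] at h
    simp only [Set.mem_ofPred_eq]
    omega
  · exact fun g => measurableSet_le
      ((measurable_groupStat t₀ m g).comp (measurable_const_add θ)) measurable_const
  · exact fun g x y hxy => congrArg (· ≤ c * √p / m) (dependsOnEntries_groupStat t₀ m g θ x y hxy)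
  · intro g hg
    have h := hP.measure_groupStat_deviation_le (g := g) hm
      ((Nat.mul_le_mul_right m (by omega)).trans hGD) h0 hn hθ₁ hθ₂ (half_pos hq0)
    refine (measure_mono fun E hE => ?_).trans (h.trans (ENNReal.ofReal_le_ofReal
      ((deviation_ratio_le hp' hm' hc hsig).trans hcs)))
    rw [Set.mem_ofPred_eq] at hE ⊢
    refine le_trans ?_ (neg_le_abs _)
    linarith

theorem IsWhiteNoise.measure_rejectionSet_null_le {p n : ℕ} {P : Measure (Fin n → Fin p → ℝ)}
    (hP : IsWhiteNoise p n P) (hp : 0 < p) {G : ℕ} {θ : Fin n → Fin p → ℝ}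
    (hθ : θ ∈ Theta0 p n) {s c : ℝ} (hs0 : 0 ≤ s) (hs1 : s ≤ 1) (hc : 1 ≤ c)
    (hcs : 12 / c ≤ s ^ 2) :
    P {E | θ + E ∈ rejectionSet p n G c} ≤ ENNReal.ofReal (n ^ 2 * (2 * s) ^ G) := by
  have e : {E | θ + E ∈ rejectionSet p n G c} =
      ⋃ q ∈ (Finset.range n ×ˢ Finset.range n).filter
        fun q => 0 < q.2 ∧ 2 * G * q.2 ≤ q.1 ∧ q.1 + 2 * G * q.2 ≤ n,
      {E | θ + E ∈ majoritySet p n G q.1 q.2 (c * √p / q.2)} := by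
    ext E
    simp [rejectionSet]
  rw [e]
  refine (measure_biUnion_finset_le _ _).trans ((Finset.sum_le_card_nsmul _ _ _ fun q hq =>
    hP.measure_majoritySet_null_le hp (Finset.mem_filter.1 hq).2.1 (Finset.mem_filter.1 hq).2.2.1
      (Finset.mem_filter.1 hq).2.2.2 hθ hs0 hs1 hc hcs).trans ?_)
  rw [nsmul_eq_mul, ENNReal.ofReal_mul (by positivity)]
  gcongr
  have hcard := Finset.card_filter_le (Finset.range n ×ˢ Finset.range n)
    fun q => 0 < q.2 ∧ 2 * G * q.2 ≤ q.1 ∧ q.1 + 2 * G * q.2 ≤ n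
  rw [Finset.card_product, Finset.card_range, ← sq] at hcard
  rw [← Nat.cast_pow, ENNReal.ofReal_natCast]
  exact_mod_cast hcard

theorem IsWhiteNoise.measure_rejectionSet_compl_le {p n : ℕ} {P : Measure (Fin n → Fin p → ℝ)}
    (hP : IsWhiteNoise p n P) (hp : 0 < p) {G : ℕ} (hG : 0 < G) (hGn : G ≤ 2 * Real.log n)
    {θ : Fin n → Fin p → ℝ} {ρ : ℝ} (hθ : θ ∈ ThetaMulti p n ρ) {s c : ℝ} (hs0 : 0 ≤ s)
    (hs1 : s ≤ 1) (hc : 1 ≤ c) (hcs : 12 / c ≤ s ^ 2) (hρ : 16 * c * √p * Real.log n ≤ ρ ^ 2) :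
    P {E | θ + E ∉ rejectionSet p n G c} ≤ ENNReal.ofReal ((2 * s) ^ G) := by
  obtain ⟨k, -, τ, μ, -, hτk, hτ, hμ, i, hi1, hik, hlog, hsig⟩ := hθ
  set D := min (τ i - τ (i - 1)) (τ (i + 1) - τ i) with hDdef
  have hlast : τ (i + 1) ≤ n := by
    rw [← hτk]
    suffices ∀ j, i + 1 ≤ j → j ≤ k + 1 → τ (i + 1) ≤ τ j from this _ (by omega) le_rfl
    intro j hj
    induction j, hj using Nat.le_induction with
    | base => exact fun _ => le_rfl
    | succ j _ ih => exact fun hjk => (ih (by omega)).trans (hτ j (by omega)).le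
  have hlt : τ i < τ (i + 1) := hτ i hik
  have hlt' : τ (i - 1) < τ i := by
    have := hτ (i - 1) (by omega)
    rwa [Nat.sub_add_cancel hi1] at this
  have hGpos : (0 : ℝ) < G := by exact_mod_cast hG
  have hlogpos : 0 < Real.log n := by linarith
  have h2G : 2 * G ≤ D := by
    have : ((2 * G : ℕ) : ℝ) ≤ D := by push_cast; linarith
    exact_mod_cast this
  set m := D / (2 * G) with hmdef
  have hm : 0 < m := Nat.div_pos h2G (by omega)
  have hGD : 2 * G * m ≤ D := Nat.mul_div_le D (2 * G)
  have hD4 : (D : ℝ) ≤ 8 * Real.log n * m := by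
    have h1 : D < 2 * G * (m + 1) := Nat.lt_mul_div_succ D (by omega)
    have h2 : D ≤ 4 * G * m := by nlinarith
    calc (D : ℝ) ≤ 4 * G * m := by exact_mod_cast h2
      _ ≤ 8 * Real.log n * m :=
        mul_le_mul_of_nonneg_right (by linarith) (Nat.cast_nonneg m)
  have hq0 : 0 ≤ sqnorm p (fun j => μ (i + 1) j - μ i j) := Finset.sum_nonneg fun _ _ => sq_nonneg _
  have hsig' : 2 * (c * √p) ≤ sqnorm p (fun j => μ (i + 1) j - μ i j) * m := by
    have h1 := hρ.trans (hsig.trans (mul_le_mul_of_nonneg_left hD4 hq0))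
    refine le_of_mul_le_mul_right ?_ (by positivity : 0 < 8 * Real.log n)
    linarith
  refine le_trans (measure_mono ?_)
    (hP.measure_majoritySet_compl_le (t₀ := τ i) hp hm hGD (by omega) (by omega)
      (fun t h1 h2 => hμ i hi1 (by omega) t (by omega) h2)
      (fun t h1 h2 => hμ (i + 1) (by omega) (by omega) t (by simpa using h1) (by omega))
      hs0 hs1 hc hcs hsig')
  have hmG : m ≤ 2 * G * m := Nat.le_mul_of_pos_left m (by omega)
  intro E hE hmem
  refine hE (Set.mem_biUnion (x := (τ i, m)) ?_ hmem)
  simp only [Finset.coe_filter, Finset.mem_product, Finset.mem_range, Set.mem_ofPred_eq]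
  omega

theorem sq_mul_pow_floor_log_le {n : ℕ} (hn : 50 ≤ n) {δ : ℝ} (hδ0 : 0 ≤ δ) (hδ1 : δ ≤ 1) :
    (n : ℝ) ^ 2 * (δ * Real.exp (-3)) ^ ⌊2 * Real.log n⌋₊ ≤ δ := by
  have hn' : (50 : ℝ) ≤ n := by exact_mod_cast hn
  have hn0 : (0 : ℝ) < n := by linarith
  have hlog : 1 ≤ Real.log n := by
    rw [Real.le_log_iff_exp_le hn0]
    linarith [Real.exp_one_lt_d9]
  have hG : Real.log n ≤ ⌊2 * Real.log n⌋₊ := by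
    have := Nat.lt_floor_add_one (2 * Real.log n)
    linarith
  have hG0 : ⌊2 * Real.log n⌋₊ ≠ 0 := by
    intro h
    rw [h, Nat.cast_zero] at hG
    linarith
  have h1 : δ ^ ⌊2 * Real.log n⌋₊ ≤ δ := pow_le_of_le_one hδ0 hδ1 hG0
  have h2 : (n : ℝ) ^ 2 * Real.exp (-3) ^ ⌊2 * Real.log n⌋₊ ≤ 1 := by
    have e : (n : ℝ) ^ 2 = Real.exp (2 * Real.log n) := by
      rw [mul_comm, Real.exp_mul, Real.exp_log hn0]
      norm_num
    rw [e, ← Real.exp_nat_mul, ← Real.exp_add]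
    refine Real.exp_le_one_iff.2 ?_
    linarith
  calc (n : ℝ) ^ 2 * (δ * Real.exp (-3)) ^ ⌊2 * Real.log n⌋₊
      = δ ^ ⌊2 * Real.log n⌋₊ * ((n : ℝ) ^ 2 * Real.exp (-3) ^ ⌊2 * Real.log n⌋₊) := by
        rw [mul_pow]; ring
    _ ≤ δ * 1 := by gcongr
    _ = δ := mul_one δ

theorem risk_indicator_le {p n : ℕ} {Q : Set (Measure (Fin n → Fin p → ℝ))}
    {Θ : Set (Fin n → Fin p → ℝ)} {R : Set (Fin n → Fin p → ℝ)} (hR : MeasurableSet R)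
    {β γ : ℝ} (hβ : 0 ≤ β) (hγ : 0 ≤ γ)
    (h0 : ∀ P ∈ Q, ∀ θ ∈ Theta0 p n, P {E | θ + E ∈ R} ≤ ENNReal.ofReal β)
    (h1 : ∀ P ∈ Q, ∀ θ ∈ Θ, P {E | θ + E ∉ R} ≤ ENNReal.ofReal γ) :
    risk p n Q Θ (R.indicator 1) ≤ β + γ := by
  have hmeas : ∀ θ : Fin n → Fin p → ℝ, MeasurableSet {E | θ + E ∈ R} := fun θ =>
    (measurable_const_add θ) hR
  refine add_le_add ?_ ?_
  · refine Real.iSup_le (fun P => Real.iSup_le (fun hP => Real.iSup_le (fun θ =>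
      Real.iSup_le (fun hθ => ?_) hβ) hβ) hβ) hβ
    have e : (fun E => R.indicator (1 : (Fin n → Fin p → ℝ) → ℝ) (θ + E)) =
        {E | θ + E ∈ R}.indicator 1 := by
      ext E; simp [Set.indicator_apply]
    rw [e, integral_indicator_one (hmeas θ)]
    exact ENNReal.toReal_le_of_le_ofReal hβ (h0 P hP θ hθ)
  · refine Real.iSup_le (fun P => Real.iSup_le (fun hP => Real.iSup_le (fun θ =>
      Real.iSup_le (fun hθ => ?_) hγ) hγ) hγ) hγ
    have e : (fun E => 1 - R.indicator (1 : (Fin n → Fin p → ℝ) → ℝ) (θ + E)) =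
        {E | θ + E ∉ R}.indicator 1 := by
      ext E; by_cases h : θ + E ∈ R <;> simp [h]
    have hc : MeasurableSet {E | θ + E ∉ R} := (hmeas θ).compl
    rw [e, integral_indicator_one hc]
    exact ENNReal.toReal_le_of_le_ofReal hγ (h1 P hP θ hθ)

/-- Theorem: testing against multiple change points, upper bound. -/
theorem statement_8 (α K ε : ℝ) (hα : 4 ≤ α) (hK : 0 < K) (hε0 : 0 < ε) (hε1 : ε < 1) :
    ∃ C : ℝ, 0 < C ∧
      ∀ p n : ℕ, 0 < p → 50 ≤ n →
        ∃ φ : (Fin n → Fin p → ℝ) → ℝ, IsTest p n φ ∧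
          ∀ ρ : ℝ, C * Real.sqrt (p : ℝ) * Real.log (n : ℝ) ≤ ρ ^ 2 →
            risk p n (Pclass p n α K) (ThetaMulti p n ρ) φ ≤ ε := by
  set s : ℝ := ε / 4 * Real.exp (-3) with hs
  have hs0 : 0 < s := by positivity
  have hs1 : s ≤ 1 := by
    have : Real.exp (-3) ≤ 1 := Real.exp_le_one_iff.2 (by norm_num)
    exact mul_le_one₀ (by linarith) (Real.exp_pos _).le this
  have h2s : 2 * s = ε / 2 * Real.exp (-3) := by rw [hs]; ring
  have hc : 1 ≤ 12 / s ^ 2 := by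
    rw [one_le_div (by positivity)]
    exact (pow_le_one₀ hs0.le hs1).trans (by norm_num)
  have hcs : 12 / (12 / s ^ 2) ≤ s ^ 2 := by
    rw [div_div_cancel₀ (by norm_num)]
  refine ⟨16 * (12 / s ^ 2), by positivity, fun p n hp hn => ?_⟩
  have hn' : (50 : ℝ) ≤ n := by exact_mod_cast hn
  have hlog : 1 ≤ Real.log n := by
    rw [Real.le_log_iff_exp_le (by linarith)]
    linarith [Real.exp_one_lt_d9]
  set G := ⌊2 * Real.log n⌋₊ with hGdef
  have hG : 0 < G := Nat.floor_pos.2 (by linarith)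
  have hGn : (G : ℝ) ≤ 2 * Real.log n := Nat.floor_le (by linarith)
  have hunion : (n : ℝ) ^ 2 * (2 * s) ^ G ≤ ε / 2 := by
    rw [h2s]
    exact sq_mul_pow_floor_log_le hn (by linarith) (by linarith)
  have hone : (2 * s) ^ G ≤ ε / 2 :=
    (le_mul_of_one_le_left (by positivity) (one_le_pow₀ (by linarith))).trans hunion
  have hR := measurableSet_rejectionSet p n G (12 / s ^ 2)
  refine ⟨(rejectionSet p n G (12 / s ^ 2)).indicator 1,
    ⟨measurable_one.indicator hR, fun x => ?_⟩, fun ρ hρ => ?_⟩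
  · by_cases hx : x ∈ rejectionSet p n G (12 / s ^ 2) <;> simp [hx]
  · have h := risk_indicator_le (Q := Pclass p n α K) (Θ := ThetaMulti p n ρ) hR
      (half_pos hε0).le (half_pos hε0).le
      (fun P hP θ hθ => ((isWhiteNoise_of_mem_Pclass hP).measure_rejectionSet_null_le hp hθ
        hs0.le hs1 hc hcs).trans (ENNReal.ofReal_le_ofReal hunion))
      (fun P hP θ hθ => ((isWhiteNoise_of_mem_Pclass hP).measure_rejectionSet_compl_le hp hG hGn hθ
        hs0.le hs1 hc hcs hρ).trans (ENNReal.ofReal_le_ofReal hone))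
    linarith

end ChangePoint
end

section
/- Let n ≥ 72, α ≥ 4 and K ≥ √(α+1). Then there exists an absolute constant c > 0 such that inf over all measurable tests φ of R_{P_{α,K}^⊗, multi}(ρ, φ) is at least 1/2 whenever ρ² ≤ c·(√(p·log(n)) + log(n)). -/
open MeasureTheory
open scoped Classical

namespace ChangePoint

section LowerBound

open Finset

/-- The support points `-√2, 0, √2` of the three-point noise. -/
noncomputable def atom : Fin 3 → ℝ := ![-Real.sqrt 2, 0, Real.sqrt 2]

/-- The masses of the centred three-point law. -/
noncomputable def baseMass : Fin 3 → ℝ := ![1 / 4, 1 / 2, 1 / 4]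

/-- The likelihood ratio on the support points that shifts the mean of the three-point law to `δ`
and keeps its variance equal to `1`. -/
noncomputable def tilt (δ : ℝ) : Fin 3 → ℝ :=
  ![1 - Real.sqrt 2 * δ + δ ^ 2, 1 - δ ^ 2, 1 + Real.sqrt 2 * δ + δ ^ 2]

/-- The law of the noise `W - δ`, where `W` has the tilted three-point law with mean `δ`. -/
noncomputable def noiseLaw (δ : ℝ) : Measure ℝ :=
  ∑ i, ENNReal.ofReal (baseMass i * tilt δ i) • Measure.dirac (atom i - δ)

lemma baseMass_nonneg (i : Fin 3) : 0 ≤ baseMass i := by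
  fin_cases i <;> norm_num [baseMass]

lemma tilt_nonneg {δ : ℝ} (hδ : |δ| ≤ 1 / 2) (i : Fin 3) : 0 ≤ tilt δ i := by
  have h2 : Real.sqrt 2 ^ 2 = 2 := Real.sq_sqrt (by norm_num)
  have hd : δ ^ 2 ≤ 1 := by nlinarith [abs_le.mp hδ]
  fin_cases i
  · simp only [tilt, Fin.zero_eta, Matrix.cons_val_zero]
    nlinarith [sq_nonneg (1 - Real.sqrt 2 * δ)]
  · simpa [tilt] using hd
  · simp only [tilt, Fin.reduceFinMk, Matrix.cons_val]
    nlinarith [sq_nonneg (1 + Real.sqrt 2 * δ)]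

@[simp] lemma tilt_zero (i : Fin 3) : tilt 0 i = 1 := by
  fin_cases i <;> simp [tilt]

lemma sum_baseMass_mul_tilt_mul_tilt (δ ε : ℝ) :
    ∑ i, baseMass i * tilt δ i * tilt ε i = 1 + δ * ε + δ ^ 2 * ε ^ 2 := by
  have h2 : Real.sqrt 2 ^ 2 = 2 := Real.sq_sqrt (by norm_num)
  simp only [Fin.sum_univ_three, baseMass, tilt, Matrix.cons_val_zero, Matrix.cons_val_one,
    Matrix.cons_val]
  linear_combination (δ * ε / 2) * h2

lemma sum_baseMass_mul_tilt (δ : ℝ) : ∑ i, baseMass i * tilt δ i = 1 := by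
  simpa using sum_baseMass_mul_tilt_mul_tilt δ 0

lemma noiseLaw_apply (δ : ℝ) {s : Set ℝ} (hs : MeasurableSet s) :
    noiseLaw δ s =
      ∑ i, ENNReal.ofReal (baseMass i * tilt δ i) * s.indicator 1 (atom i - δ) := by
  simp [noiseLaw, hs]

lemma lintegral_noiseLaw (δ : ℝ) (f : ℝ → ENNReal) :
    ∫⁻ x, f x ∂noiseLaw δ =
      ∑ i, ENNReal.ofReal (baseMass i * tilt δ i) * f (atom i - δ) := by
  simp [noiseLaw, lintegral_smul_measure]

lemma lintegral_noiseLaw_ofReal {δ : ℝ} (hδ : |δ| ≤ 1 / 2) {f : ℝ → ℝ} (hf : ∀ x, 0 ≤ f x) :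
    ∫⁻ x, ENNReal.ofReal (f x) ∂noiseLaw δ =
      ENNReal.ofReal (∑ i, baseMass i * tilt δ i * f (atom i - δ)) := by
  have h (i : Fin 3) : 0 ≤ baseMass i * tilt δ i :=
    mul_nonneg (baseMass_nonneg i) (tilt_nonneg hδ i)
  rw [lintegral_noiseLaw, ENNReal.ofReal_sum_of_nonneg fun i _ => mul_nonneg (h i) (hf _)]
  exact sum_congr rfl fun i _ => (ENNReal.ofReal_mul (h i)).symm

lemma abs_atom_sub_le {δ : ℝ} (hδ : |δ| ≤ 1 / 2) (i : Fin 3) : |atom i - δ| ≤ 2 := by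
  have h2 : Real.sqrt 2 ≤ 3 / 2 := Real.sqrt_le_iff.mpr (by norm_num)
  have h0 := Real.sqrt_nonneg 2
  have := abs_le.mp hδ
  fin_cases i <;> simp [atom] <;> rw [abs_le] <;> constructor <;> linarith

lemma memP_noiseLaw {α K δ : ℝ} (hα : 0 ≤ α) (hK : 2 ≤ K) (hδ : |δ| ≤ 1 / 2) :
    memP α K (noiseLaw δ) := by
  have h2 : Real.sqrt 2 ^ 2 = 2 := Real.sq_sqrt (by norm_num)
  have hw (i : Fin 3) : 0 ≤ baseMass i * tilt δ i :=
    mul_nonneg (baseMass_nonneg i) (tilt_nonneg hδ i)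
  have hint (f : ℝ → ℝ) (i : Fin 3) :
      Integrable f (ENNReal.ofReal (baseMass i * tilt δ i) • Measure.dirac (atom i - δ)) :=
    (integrable_dirac (by simp)).smul_measure ENNReal.ofReal_ne_top
  refine ⟨⟨?_⟩, ?_, ?_, ?_, ?_⟩
  · have := lintegral_noiseLaw_ofReal hδ (f := fun _ => 1) (fun _ => zero_le_one)
    simpa [sum_baseMass_mul_tilt] using this
  · exact integrable_finsetSum_measure.2 fun i _ => hint _ i
  · rw [noiseLaw, integral_finsetSum_measure fun i _ => hint _ i]
    simp only [integral_smul_measure, integral_dirac, ENNReal.toReal_ofReal (hw _), smul_eq_mul]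
    simp only [Fin.sum_univ_three, baseMass, tilt, atom, Matrix.cons_val_zero,
      Matrix.cons_val_one, Matrix.cons_val]
    linear_combination (δ / 2) * h2
  · rw [lintegral_noiseLaw_ofReal hδ sq_nonneg, ENNReal.ofReal_eq_one]
    simp only [Fin.sum_univ_three, baseMass, tilt, atom, Matrix.cons_val_zero,
      Matrix.cons_val_one, Matrix.cons_val]
    linear_combination (1 / 2 - δ ^ 2 / 2) * h2
  · rw [lintegral_noiseLaw_ofReal hδ fun x => by positivity, ENNReal.ofReal_le_one]
    calc _ ≤ ∑ i, baseMass i * tilt δ i * 1 := by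
          refine sum_le_sum fun i _ => mul_le_mul_of_nonneg_left ?_ (hw i)
          refine Real.rpow_le_one (abs_nonneg _) ?_ hα
          rw [abs_div, abs_of_nonneg (by linarith : (0 : ℝ) ≤ K)]
          exact div_le_one_of_le₀ ((abs_atom_sub_le hδ i).trans hK) (by linarith)
      _ = 1 := by simpa using sum_baseMass_mul_tilt δ

/-- The joint law of independent noise entries, the `(t, j)` entry having law
`noiseLaw (θ t j)`. -/
noncomputable def noiseMatrixLaw (p n : ℕ) (θ : Fin n → Fin p → ℝ) : Measure (Fin n → Fin p → ℝ) :=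
  ∑ ω : Fin n → Fin p → Fin 3,
    ENNReal.ofReal (∏ t, ∏ j, baseMass (ω t j) * tilt (θ t j) (ω t j)) •
      Measure.dirac fun t j => atom (ω t j) - θ t j

lemma prod_prod_sum {p n : ℕ} {R : Type*} [CommSemiring R] (f : Fin n → Fin p → Fin 3 → R) :
    ∏ t, ∏ j, ∑ i, f t j i = ∑ ω : Fin n → Fin p → Fin 3, ∏ t, ∏ j, f t j (ω t j) := by
  simp_rw [Fintype.prod_sum]

lemma isEntrywiseProduct_noiseMatrixLaw {p n : ℕ} {θ : Fin n → Fin p → ℝ}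
    (hθ : ∀ t j, |θ t j| ≤ 1 / 2) :
    IsEntrywiseProduct p n (noiseMatrixLaw p n θ) fun t j => noiseLaw (θ t j) := by
  have hw (t j) (i : Fin 3) : 0 ≤ baseMass i * tilt (θ t j) i :=
    mul_nonneg (baseMass_nonneg i) (tilt_nonneg (hθ t j) i)
  have hrect (s : Fin n → Fin p → Set ℝ) (hs : ∀ t j, MeasurableSet (s t j)) :
      noiseMatrixLaw p n θ {x | ∀ t j, x t j ∈ s t j} = ∏ t, ∏ j, noiseLaw (θ t j) (s t j) := by
    have hmeas : MeasurableSet {x : Fin n → Fin p → ℝ | ∀ t j, x t j ∈ s t j} := by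
      have : {x : Fin n → Fin p → ℝ | ∀ t j, x t j ∈ s t j} =
          Set.univ.pi fun t => Set.univ.pi fun j => s t j := by
        ext x; simp [Set.mem_pi]
      rw [this]
      exact MeasurableSet.univ_pi fun t => MeasurableSet.univ_pi fun j => hs t j
    simp_rw [noiseLaw_apply _ (hs _ _), prod_prod_sum, noiseMatrixLaw]
    simp only [Measure.coe_finsetSum, Finset.sum_apply, Measure.smul_apply, smul_eq_mul]
    refine sum_congr rfl fun ω _ => ?_
    simp_rw [prod_mul_distrib]
    rw [Measure.dirac_apply' _ hmeas]
    simp_rw [← prod_mul_distrib]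
    rw [ENNReal.ofReal_prod_of_nonneg fun t _ => prod_nonneg fun j _ => hw t j _]
    simp_rw [ENNReal.ofReal_prod_of_nonneg fun j _ => hw _ j _, prod_mul_distrib]
    congr 1
    by_cases h : ∀ t j, atom (ω t j) - θ t j ∈ s t j
    · rw [Set.indicator_of_mem (by exact h)]
      simp [h]
    · rw [Set.indicator_of_notMem (by exact h)]
      push Not at h
      obtain ⟨t, j, htj⟩ := h
      exact (prod_eq_zero (mem_univ t) (prod_eq_zero (mem_univ j) (by simp [htj]))).symm
  refine ⟨⟨?_⟩, hrect⟩
  have h := hrect (fun _ _ => Set.univ) fun _ _ => MeasurableSet.univ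
  have h1 (t j) : noiseLaw (θ t j) Set.univ = 1 :=
    (memP_noiseLaw (α := 0) le_rfl le_rfl (hθ t j)).1.measure_univ
  simpa [h1] using h

lemma noiseMatrixLaw_mem_Pclass {p n : ℕ} {α K : ℝ} (hα : 0 ≤ α) (hK : 2 ≤ K)
    {θ : Fin n → Fin p → ℝ} (hθ : ∀ t j, |θ t j| ≤ 1 / 2) :
    noiseMatrixLaw p n θ ∈ Pclass p n α K :=
  ⟨_, fun t j => memP_noiseLaw hα hK (hθ t j), isEntrywiseProduct_noiseMatrixLaw hθ⟩

lemma integral_noiseMatrixLaw {p n : ℕ} {θ : Fin n → Fin p → ℝ}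
    (hθ : ∀ t j, |θ t j| ≤ 1 / 2) (f : (Fin n → Fin p → ℝ) → ℝ) :
    ∫ E, f (θ + E) ∂noiseMatrixLaw p n θ =
      ∑ ω : Fin n → Fin p → Fin 3, (∏ t, ∏ j, baseMass (ω t j)) *
        (∏ t, ∏ j, tilt (θ t j) (ω t j)) * f fun t j => atom (ω t j) := by
  rw [noiseMatrixLaw, integral_finsetSum_measure fun ω _ =>
    (integrable_dirac (by simp)).smul_measure ENNReal.ofReal_ne_top]
  refine sum_congr rfl fun ω _ => ?_
  have hθω : (θ + fun t j => atom (ω t j) - θ t j) = fun t j => atom (ω t j) := by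
    ext t j; simp
  rw [integral_smul_measure, integral_dirac, hθω, smul_eq_mul, ENNReal.toReal_ofReal]
  · simp_rw [prod_mul_distrib]
  · exact prod_nonneg fun t _ => prod_nonneg fun j _ =>
      mul_nonneg (baseMass_nonneg _) (tilt_nonneg (hθ t j) _)

lemma sum_prod_baseMass_mul_tilt_mul_tilt {p n : ℕ} (θ θ' : Fin n → Fin p → ℝ) :
    ∑ ω : Fin n → Fin p → Fin 3, (∏ t, ∏ j, baseMass (ω t j)) *
        (∏ t, ∏ j, tilt (θ t j) (ω t j)) * (∏ t, ∏ j, tilt (θ' t j) (ω t j)) =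
      ∏ t, ∏ j, (1 + θ t j * θ' t j + θ t j ^ 2 * θ' t j ^ 2) := by
  simp_rw [← sum_baseMass_mul_tilt_mul_tilt, prod_prod_sum, prod_mul_distrib]

/-- The second-moment method for a mixture of likelihood ratios on a finite space. -/
lemma half_le_of_sum_sq_le {Ω A : Type*} [Fintype Ω] [Fintype A] [Nonempty A]
    {q φ : Ω → ℝ} {l : A → Ω → ℝ} {a b : ℝ} (hq : ∀ ω, 0 ≤ q ω)
    (hl : ∀ i, ∑ ω, q ω * l i ω = 1) (hφ : ∀ ω, φ ω = 0 ∨ φ ω = 1)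
    (hsq : ∑ i, ∑ j, ∑ ω, q ω * l i ω * l j ω ≤ 2 * (Fintype.card A : ℝ) ^ 2)
    (ha : ∑ ω, q ω * φ ω ≤ a) (hb : ∀ i, ∑ ω, q ω * l i ω * (1 - φ ω) ≤ b) :
    1 / 2 ≤ a + b := by
  set N : ℝ := (Fintype.card A : ℝ) with hN
  have hN0 : 0 < N := by simp [hN, Fintype.card_pos]
  set L : Ω → ℝ := fun ω => (∑ i, l i ω) / N with hL
  have hL1 : ∑ ω, q ω * L ω = 1 := by
    calc ∑ ω, q ω * L ω = (∑ i, ∑ ω, q ω * l i ω) / N := by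
          rw [sum_comm, sum_div]
          exact sum_congr rfl fun ω _ => by rw [hL, ← mul_sum, mul_div_assoc]
      _ = 1 := by simp [hl, ← hN, hN0.ne']
  have hL2 : ∑ ω, q ω * L ω ^ 2 ≤ 2 := by
    have : ∑ ω, q ω * L ω ^ 2 = (∑ i, ∑ j, ∑ ω, q ω * l i ω * l j ω) / N ^ 2 := by
      have h (i : A) : ∑ j, ∑ ω, q ω * l i ω * l j ω = ∑ ω, q ω * l i ω * ∑ j, l j ω := by
        rw [sum_comm]
        simp_rw [mul_sum]
      simp_rw [h]
      rw [sum_comm, sum_div]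
      refine sum_congr rfl fun ω _ => ?_
      rw [← sum_mul, ← mul_sum, hL]
      ring
    rw [this, div_le_iff₀ (by positivity)]
    exact hsq
  have hbL : ∑ ω, q ω * L ω * (1 - φ ω) ≤ b := by
    have : ∑ ω, q ω * L ω * (1 - φ ω) = (∑ i, ∑ ω, q ω * l i ω * (1 - φ ω)) / N := by
      rw [sum_comm, sum_div]
      refine sum_congr rfl fun ω _ => ?_
      rw [← sum_mul, ← mul_sum, hL]
      ring
    rw [this, div_le_iff₀ hN0]
    calc _ ≤ ∑ _i : A, b := sum_le_sum fun i _ => hb i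
      _ = b * N := by simp [← hN, mul_comm]
  have key : ∑ ω, (q ω * L ω - q ω * L ω ^ 2 / 4) ≤
      ∑ ω, (q ω * φ ω + q ω * L ω * (1 - φ ω)) := by
    refine sum_le_sum fun ω _ => ?_
    rcases hφ ω with h | h <;> rw [h] <;> nlinarith [hq ω, sq_nonneg (L ω),
      mul_nonneg (hq ω) (sq_nonneg (L ω)), mul_nonneg (hq ω) (sq_nonneg (L ω - 2))]
  rw [sum_add_distrib, sum_sub_distrib, ← sum_div, hL1] at key
  linarith

lemma half_le_risk {p n : ℕ} {α K : ℝ} (hα : 0 ≤ α) (hK : 2 ≤ K)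
    {Θalt : Set (Fin n → Fin p → ℝ)} {φ : (Fin n → Fin p → ℝ) → ℝ} (hφ : IsTest p n φ)
    {A : Type*} [Fintype A] [Nonempty A] {θ : A → Fin n → Fin p → ℝ} (hmem : ∀ a, θ a ∈ Θalt)
    (hθ : ∀ a t j, |θ a t j| ≤ 1 / 2)
    (hsq : ∑ a, ∑ b, ∏ t, ∏ j, (1 + θ a t j * θ b t j + θ a t j ^ 2 * θ b t j ^ 2) ≤
      2 * (Fintype.card A : ℝ) ^ 2) :
    1 / 2 ≤ risk p n (Pclass p n α K) Θalt φ := by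
  have hφ0 (x) : 0 ≤ φ x := by rcases hφ.2 x with h | h <;> simp [h]
  have hφ1 (x) : φ x ≤ 1 := by rcases hφ.2 x with h | h <;> simp [h]
  have hsup {f : (Fin n → Fin p → ℝ) → ℝ} (hf0 : ∀ x, 0 ≤ f x) (hf1 : ∀ x, f x ≤ 1)
      {T : Set (Fin n → Fin p → ℝ)} {P : Measure (Fin n → Fin p → ℝ)}
      (hP : P ∈ Pclass p n α K) {η : Fin n → Fin p → ℝ} (hη : η ∈ T) :
      ∫ E, f (η + E) ∂P ≤ ⨆ P ∈ Pclass p n α K, ⨆ η ∈ T, ∫ E, f (η + E) ∂P := by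
    have hle {P} (hP : P ∈ Pclass p n α K) (η) : ∫ E, f (η + E) ∂P ≤ 1 := by
      obtain ⟨_, _, hprob, _⟩ := hP
      calc ∫ E, f (η + E) ∂P ≤ ∫ _E, (1 : ℝ) ∂P :=
            integral_mono_of_nonneg (.of_forall fun _ => hf0 _) (integrable_const _)
              (.of_forall fun _ => hf1 _)
        _ = 1 := by simp
    have h1 {P} (hP : P ∈ Pclass p n α K) (η) : ⨆ (_ : η ∈ T), ∫ E, f (η + E) ∂P ≤ 1 :=
      Real.iSup_le (fun _ => hle hP η) zero_le_one
    have h2 {P} (hP : P ∈ Pclass p n α K) : ⨆ η ∈ T, ∫ E, f (η + E) ∂P ≤ 1 :=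
      Real.iSup_le (h1 hP) zero_le_one
    have h3 (P) : ⨆ (_ : P ∈ Pclass p n α K), ⨆ η ∈ T, ∫ E, f (η + E) ∂P ≤ 1 :=
      Real.iSup_le h2 zero_le_one
    refine le_ciSup_of_le ⟨1, Set.forall_mem_range.2 h3⟩ P ?_
    refine le_ciSup_of_le ⟨1, Set.forall_mem_range.2 h2⟩ hP ?_
    refine le_ciSup_of_le ⟨1, Set.forall_mem_range.2 (h1 hP)⟩ η ?_
    exact le_ciSup_of_le ⟨1, Set.forall_mem_range.2 fun _ => hle hP η⟩ hη le_rfl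
  have h0 (t : Fin n) (j : Fin p) : |(0 : Fin n → Fin p → ℝ) t j| ≤ 1 / 2 := by simp
  refine half_le_of_sum_sq_le (q := fun ω : Fin n → Fin p → Fin 3 => ∏ t, ∏ j, baseMass (ω t j))
    (φ := fun ω => φ fun t j => atom (ω t j)) (l := fun a ω => ∏ t, ∏ j, tilt (θ a t j) (ω t j))
    (fun ω => prod_nonneg fun t _ => prod_nonneg fun j _ => baseMass_nonneg _) ?_
    (fun ω => hφ.2 _) ?_ ?_ ?_
  · intro a
    simpa using sum_prod_baseMass_mul_tilt_mul_tilt (θ a) 0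
  · simpa only [sum_prod_baseMass_mul_tilt_mul_tilt] using hsq
  · have := hsup hφ0 hφ1 (T := Theta0 p n) (noiseMatrixLaw_mem_Pclass hα hK h0)
      (⟨0, fun _ => rfl⟩ : (0 : Fin n → Fin p → ℝ) ∈ Theta0 p n)
    rw [integral_noiseMatrixLaw h0] at this
    simpa using this
  · intro a
    have := hsup (f := fun x => 1 - φ x) (fun x => sub_nonneg.2 (hφ1 x))
      (fun x => sub_le_self _ (hφ0 x)) (noiseMatrixLaw_mem_Pclass hα hK (hθ a)) (hmem a)
    rwa [integral_noiseMatrixLaw (hθ a) fun x => 1 - φ x] at this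

/-- The sign `±1` encoded by a Boolean. -/
def boolSign (b : Bool) : ℝ := if b then 1 else -1

/-- The signal equal to `δ` times the sign pattern `s.2` on the `(s.1 + 2)`-nd block of `Δ`
consecutive time points and to `0` elsewhere. -/
noncomputable def blockSignal (p n Δ M : ℕ) (δ : ℝ) (s : Fin M × (Fin p → Bool)) (t : Fin n)
    (j : Fin p) : ℝ :=
  if (t : ℕ) / Δ = s.1 + 1 then δ * boolSign (s.2 j) else 0

lemma blockSignal_mem_ThetaMulti {p n Δ M : ℕ} {δ ρ : ℝ} (hΔ : 4 * Real.log n ≤ Δ)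
    (hΔ0 : 0 < Δ) (hn : (M + 2) * Δ ≤ n) (hρ : ρ ^ 2 ≤ p * δ ^ 2 * Δ)
    (s : Fin M × (Fin p → Bool)) : blockSignal p n Δ M δ s ∈ ThetaMulti p n ρ := by
  obtain ⟨l, ε⟩ := s
  have hl : ((l : ℕ) + 1) * Δ + Δ + Δ ≤ n := by
    calc _ = ((l : ℕ) + 1 + 2) * Δ := by ring
      _ ≤ (M + 2) * Δ := by gcongr; exact l.2
      _ ≤ n := hn
  have hl' : Δ ≤ ((l : ℕ) + 1) * Δ := by nlinarith
  have hdiv (t : ℕ) : t / Δ = (l : ℕ) + 1 ↔ ((l : ℕ) + 1) * Δ ≤ t ∧ t < ((l : ℕ) + 1) * Δ + Δ := by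
    rw [Nat.div_eq_iff hΔ0]
    omega
  set a := ((l : ℕ) + 1) * Δ
  refine ⟨2, by norm_num, fun i => if i = 0 then 0 else if i = 1 then a else
    if i = 2 then a + Δ else n, fun i => if i = 2 then fun j => δ * boolSign (ε j) else 0,
    by simp, by simp, ?_, ?_, 1, le_rfl, by norm_num, ?_, ?_⟩
  · intro i hi
    interval_cases i <;> simp <;> omega
  · intro i hi hi' t h1 h2
    ext j
    simp only [blockSignal, hdiv]
    interval_cases i <;> simp at h1 h2 ⊢ <;> intros <;> omega
  · simpa [Nat.min_eq_right hl'] using hΔ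
  · have hb (b : Bool) : boolSign b ^ 2 = 1 := by cases b <;> simp [boolSign]
    simpa [Nat.min_eq_right hl', sqnorm, mul_pow, hb] using hρ

lemma abs_blockSignal_le {p n Δ M : ℕ} {δ : ℝ} (hδ : |δ| ≤ 1 / 2)
    (s : Fin M × (Fin p → Bool)) (t : Fin n) (j : Fin p) :
    |blockSignal p n Δ M δ s t j| ≤ 1 / 2 := by
  unfold blockSignal boolSign
  split_ifs <;> simp_all

lemma card_filter_div_eq {n Δ l : ℕ} (hΔ : 0 < Δ) (hn : (l + 1) * Δ ≤ n) :
    #{t : Fin n | (t : ℕ) / Δ = l} = Δ := by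
  have h : (univ.filter fun t : Fin n => (t : ℕ) / Δ = l).map Fin.valEmbedding =
      Ico (l * Δ) (l * Δ + Δ) := by
    ext t
    simp only [mem_map, mem_filter, mem_univ, true_and, Fin.valEmbedding_apply, mem_Ico,
      Nat.div_eq_iff hΔ]
    rw [add_one_mul] at hn
    constructor
    · rintro ⟨t, ht, rfl⟩
      omega
    · intro ht
      exact ⟨⟨t, by omega⟩, by simp only; omega, rfl⟩
  rw [← card_map, h, Nat.card_Ico]
  omega

lemma sum_prod_blockSignal_le {p n Δ M : ℕ} {δ : ℝ} (hΔ : 0 < Δ) (hn : (M + 2) * Δ ≤ n)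
    (hH : (Real.exp (Δ * δ ^ 4) * Real.cosh (Δ * δ ^ 2)) ^ p ≤ M + 1) :
    ∑ a, ∑ b, ∏ t : Fin n, ∏ j, (1 + blockSignal p n Δ M δ a t j * blockSignal p n Δ M δ b t j +
        blockSignal p n Δ M δ a t j ^ 2 * blockSignal p n Δ M δ b t j ^ 2) ≤
      2 * (Fintype.card (Fin M × (Fin p → Bool)) : ℝ) ^ 2 := by
  set g : Bool → Bool → ℝ := fun x y =>
    (1 + (δ * boolSign x) * (δ * boolSign y) + (δ * boolSign x) ^ 2 * (δ * boolSign y) ^ 2) ^ Δ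
  have hprod (l l' : Fin M) (ε ε' : Fin p → Bool) :
      ∏ t : Fin n, ∏ j, (1 + blockSignal p n Δ M δ (l, ε) t j * blockSignal p n Δ M δ (l', ε') t j +
        blockSignal p n Δ M δ (l, ε) t j ^ 2 * blockSignal p n Δ M δ (l', ε') t j ^ 2) =
      if l = l' then ∏ j, g (ε j) (ε' j) else 1 := by
    by_cases h : l = l'
    · subst h
      have hln : ((l : ℕ) + 1 + 1) * Δ ≤ n :=
        le_trans (Nat.mul_le_mul_right Δ (by have := l.2; omega)) hn
      rw [prod_comm, if_pos rfl]
      refine prod_congr rfl fun j _ => ?_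
      calc _ = ∏ t : Fin n, if (t : ℕ) / Δ = l + 1 then
              (1 + (δ * boolSign (ε j)) * (δ * boolSign (ε' j)) +
                (δ * boolSign (ε j)) ^ 2 * (δ * boolSign (ε' j)) ^ 2) else 1 := by
            refine prod_congr rfl fun t _ => ?_
            unfold blockSignal
            split_ifs <;> simp
        _ = g (ε j) (ε' j) := by
            rw [prod_ite, prod_const, prod_const_one, mul_one]
            congr 1
            convert card_filter_div_eq hΔ hln
    · rw [if_neg h]
      refine prod_eq_one fun t _ => prod_eq_one fun j _ => ?_
      unfold blockSignal
      split_ifs with h1 h2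
      · exact absurd (Fin.ext (by simp only at h1 h2; omega)) h
      all_goals simp
  set H : ℝ := g true true + g true false with hHdef
  have hg (x : Bool) : ∑ y, g x y = H := by
    cases x <;> simp [g, boolSign, hHdef, add_comm]
  have hsum (ε : Fin p → Bool) : ∑ ε' : Fin p → Bool, ∏ j, g (ε j) (ε' j) = H ^ p := by
    rw [← Fintype.prod_sum]
    rw [prod_congr rfl fun j _ => hg (ε j), prod_const, card_univ, Fintype.card_fin]
  have hrow (l : Fin M) (ε : Fin p → Bool) :
      ∑ b : Fin M × (Fin p → Bool), ∏ t : Fin n, ∏ j,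
        (1 + blockSignal p n Δ M δ (l, ε) t j * blockSignal p n Δ M δ b t j +
        blockSignal p n Δ M δ (l, ε) t j ^ 2 * blockSignal p n Δ M δ b t j ^ 2) =
      (M - 1) * 2 ^ p + H ^ p := by
    simp_rw [Fintype.sum_prod_type, hprod]
    have h (l' : Fin M) : ∑ ε' : Fin p → Bool, (if l = l' then ∏ j, g (ε j) (ε' j) else 1) =
        2 ^ p + if l = l' then H ^ p - 2 ^ p else 0 := by
      split_ifs <;> simp [hsum]
    simp_rw [h, sum_add_distrib]
    simp
    ring
  have hHle : H ≤ 2 * (Real.exp (Δ * δ ^ 4) * Real.cosh (Δ * δ ^ 2)) := by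
    have hbd (x : ℝ) (hx : 0 ≤ 1 + x + δ ^ 4) :
        (1 + x + δ ^ 4) ^ Δ ≤ Real.exp (Δ * δ ^ 4) * Real.exp (Δ * x) := by
      rw [← Real.exp_add, ← mul_add, Real.exp_nat_mul]
      gcongr
      linarith [Real.add_one_le_exp (δ ^ 4 + x)]
    have h1 := hbd (δ ^ 2) (by positivity)
    have h2 := hbd (-δ ^ 2) (by nlinarith [sq_nonneg (δ ^ 2 - 1 / 2)])
    rw [Real.cosh_eq, ← mul_neg]
    have e1 : g true true = (1 + δ ^ 2 + δ ^ 4) ^ Δ := by simp [g, boolSign]; ring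
    have e2 : g true false = (1 + -δ ^ 2 + δ ^ 4) ^ Δ := by simp [g, boolSign]; ring
    rw [hHdef, e1, e2]
    linarith
  have hH0 : 0 ≤ H := by
    have h (b : Bool) : 0 ≤ g true b := by
      refine pow_nonneg ?_ _
      cases b <;> simp [boolSign] <;> nlinarith [sq_nonneg (δ ^ 2 - 1 / 2), sq_nonneg δ]
    exact add_nonneg (h _) (h _)
  have hHp : H ^ p ≤ 2 ^ p * (M + 1) := by
    calc H ^ p ≤ (2 * (Real.exp (Δ * δ ^ 4) * Real.cosh (Δ * δ ^ 2))) ^ p := by gcongr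
      _ ≤ 2 ^ p * (M + 1) := by rw [mul_pow]; gcongr
  calc _ = ∑ _a : Fin M × (Fin p → Bool), ((M - 1) * 2 ^ p + H ^ p) :=
        sum_congr rfl fun a _ => hrow a.1 a.2
    _ = M * 2 ^ p * ((M - 1) * 2 ^ p + H ^ p) := by simp; ring
    _ ≤ M * 2 ^ p * ((M - 1) * 2 ^ p + 2 ^ p * (M + 1)) := by gcongr
    _ = _ := by simp; ring

lemma exp_mul_cosh_pow_le {p : ℕ} (hp : 0 < p) {L D δ : ℝ} (hL : 1 ≤ L) (hD : 4 * L ≤ D)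
    (hδ : p * δ ^ 2 * D = 1 / 40 * (Real.sqrt (p * L) + L)) :
    |δ| ≤ 1 / 2 ∧ (Real.exp (D * δ ^ 4) * Real.cosh (D * δ ^ 2)) ^ p ≤ Real.exp (L / 10) := by
  have hp1 : (1 : ℝ) ≤ p := by exact_mod_cast hp
  have hs0 := Real.sqrt_nonneg (p * L)
  have hs := Real.sq_sqrt (by positivity : 0 ≤ (p : ℝ) * L)
  set s := Real.sqrt (p * L)
  set a : ℝ := D * δ ^ 2 with ha
  have ha0 : 0 ≤ a := by have := sq_nonneg δ; nlinarith
  have hpa : p * a = 1 / 40 * (s + L) := by rw [← hδ]; ring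
  have hspL : s ≤ p * L := by nlinarith [mul_le_mul hp1 hL zero_le_one (by linarith)]
  have haL : a ≤ L / 20 := by
    have : p * a ≤ p * (L / 20) := by nlinarith
    exact le_of_mul_le_mul_left this (by linarith)
  have hδ2 : δ ^ 2 ≤ 1 / 4 := by nlinarith [sq_nonneg δ]
  refine ⟨abs_le_of_sq_le_sq (by linarith) (by norm_num), ?_⟩
  have h4 : D * δ ^ 4 = a * δ ^ 2 := by rw [ha]; ring
  have hδa : δ ^ 2 ≤ a := by nlinarith [sq_nonneg δ]
  rcases le_or_gt L p with h | h
  · have hLs : L ≤ s := Real.le_sqrt_of_sq_le (by nlinarith)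
    calc (Real.exp (D * δ ^ 4) * Real.cosh a) ^ p
        ≤ (Real.exp (a ^ 2) * Real.exp (a ^ 2 / 2)) ^ p := by
          gcongr
          · nlinarith
          · exact Real.cosh_le_exp_half_sq a
      _ = Real.exp (p * (a ^ 2 + a ^ 2 / 2)) := by rw [← Real.exp_add, ← Real.exp_nat_mul]
      _ ≤ Real.exp (L / 10) := by
          gcongr
          have h1 : p * a ≤ s / 20 := by linarith
          have h2 : (p * a) ^ 2 ≤ (s / 20) ^ 2 := by gcongr
          have h3 : p * (p * a ^ 2) ≤ p * (L / 400) := by nlinarith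
          have h5 := le_of_mul_le_mul_left h3 (by linarith)
          linarith
  · have hsL : s ≤ L := Real.sqrt_le_iff.2 ⟨by linarith, by nlinarith⟩
    calc (Real.exp (D * δ ^ 4) * Real.cosh a) ^ p
        ≤ (Real.exp a * Real.exp a) ^ p := by
          gcongr
          · nlinarith
          · rw [Real.cosh_eq]
            linarith [Real.exp_le_exp.2 (by linarith : -a ≤ a)]
      _ = Real.exp (p * (a + a)) := by rw [← Real.exp_add, ← Real.exp_nat_mul]
      _ ≤ Real.exp (L / 10) := by
          gcongr
          linarith

lemma exists_block_count {n : ℕ} (hn : 72 ≤ n) :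
    ∃ M : ℕ, 0 < M ∧ (M + 2) * ⌈4 * Real.log n⌉₊ ≤ n ∧
      Real.exp (Real.log n / 10) ≤ M + 1 := by
  have hn' : (72 : ℝ) ≤ n := by exact_mod_cast hn
  have hn0 : (0 : ℝ) < n := by linarith
  set L := Real.log n
  have hexp : Real.exp L = n := Real.exp_log hn0
  have hL : 4.2 ≤ L := by
    rw [Real.le_log_iff_exp_le hn0]
    refine le_trans ?_ hn'
    have h : Real.exp 4.2 ^ 5 ≤ 72 ^ 5 := by
      rw [← Real.exp_nat_mul]
      have : ((5 : ℕ) : ℝ) * 4.2 = ((21 : ℕ) : ℝ) * 1 := by norm_num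
      rw [this, Real.exp_nat_mul]
      calc Real.exp 1 ^ 21 ≤ 2.7182818286 ^ 21 := by
            gcongr; exact Real.exp_one_lt_d9.le
        _ ≤ 72 ^ 5 := by norm_num
    exact le_of_pow_le_pow_left₀ (by norm_num) (by norm_num) h
  have h3 : 3 * (4 * L + 1) ≤ n := by
    have h4 : (54 : ℝ) ≤ Real.exp 4 := by
      have : (4 : ℝ) = ((4 : ℕ) : ℝ) * 1 := by norm_num
      rw [this, Real.exp_nat_mul]
      calc (54 : ℝ) ≤ 2.7182818283 ^ 4 := by norm_num
        _ ≤ Real.exp 1 ^ 4 := by gcongr; exact Real.exp_one_gt_d9.le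
    have : Real.exp L = Real.exp 4 * Real.exp (L - 4) := by rw [← Real.exp_add]; ring_nf
    nlinarith [Real.add_one_le_exp (L - 4)]
  have h9 : 2 * Real.exp (L / 10) * (4 * L + 1) ≤ n := by
    have h4 : (40 : ℝ) ≤ Real.exp 3.75 := by
      have h : (40 : ℝ) ^ 4 ≤ Real.exp 3.75 ^ 4 := by
        rw [← Real.exp_nat_mul]
        have : ((4 : ℕ) : ℝ) * 3.75 = ((15 : ℕ) : ℝ) * 1 := by norm_num
        rw [this, Real.exp_nat_mul]
        calc (40 : ℝ) ^ 4 ≤ 2.7182818283 ^ 15 := by norm_num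
          _ ≤ Real.exp 1 ^ 15 := by gcongr; exact Real.exp_one_gt_d9.le
      exact le_of_pow_le_pow_left₀ (by norm_num) (Real.exp_pos _).le h
    have e1 : Real.exp L = Real.exp (L / 10) * Real.exp (9 * L / 10) := by
      rw [← Real.exp_add]; ring_nf
    have e2 : Real.exp (9 * L / 10) = Real.exp 3.75 * Real.exp (9 * L / 10 - 3.75) := by
      rw [← Real.exp_add]; ring_nf
    have e3 : 2 * (4 * L + 1) ≤ Real.exp (9 * L / 10) := by
      nlinarith [Real.add_one_le_exp (9 * L / 10 - 3.75)]
    rw [← hexp, e1]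
    nlinarith [Real.exp_pos (L / 10)]
  set Δ := ⌈4 * L⌉₊ with hΔ
  have hΔ0 : 0 < Δ := Nat.ceil_pos.2 (by linarith)
  have hΔ1 : (Δ : ℝ) ≤ 4 * L + 1 := (Nat.ceil_lt_add_one (by linarith)).le
  have hq : 3 ≤ n / Δ := by
    rw [Nat.le_div_iff_mul_le hΔ0]
    have : (3 : ℝ) * Δ ≤ n := by linarith
    exact_mod_cast this
  refine ⟨n / Δ - 2, by omega, ?_, ?_⟩
  · rw [Nat.sub_add_cancel (by omega)]
    exact Nat.div_mul_le_self n Δ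
  · have hlt : (n : ℝ) < (n / Δ + 1 : ℕ) * Δ := by
      exact_mod_cast (mul_comm Δ _ ▸ Nat.lt_mul_div_succ n hΔ0 : n < (n / Δ + 1) * Δ)
    have hle : ((n / Δ + 1 : ℕ) : ℝ) ≤ 2 * ((n / Δ - 2 : ℕ) + 1) := by
      norm_cast
      omega
    have hΔpos : (0 : ℝ) < Δ := by exact_mod_cast hΔ0
    have : 2 * Real.exp (L / 10) * Δ ≤ 2 * ((n / Δ - 2 : ℕ) + 1) * Δ := by
      calc _ ≤ 2 * Real.exp (L / 10) * (4 * L + 1) := by gcongr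
        _ ≤ n := h9
        _ ≤ (n / Δ + 1 : ℕ) * Δ := hlt.le
        _ ≤ _ := by gcongr
    have := le_of_mul_le_mul_right this hΔpos
    linarith

end LowerBound

/-- Proposition: multiple change points, minimax lower bound. -/
theorem statement_9 :
    ∃ c : ℝ, 0 < c ∧
      ∀ (p n : ℕ) (α K : ℝ), 0 < p → 72 ≤ n → 4 ≤ α → Real.sqrt (α + 1) ≤ K →
        ∀ ρ : ℝ, ρ ^ 2 ≤ c * (Real.sqrt ((p : ℝ) * Real.log (n : ℝ)) + Real.log (n : ℝ)) →
          ∀ φ : (Fin n → Fin p → ℝ) → ℝ, IsTest p n φ →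
            1 / 2 ≤ risk p n (Pclass p n α K) (ThetaMulti p n ρ) φ := by
  refine ⟨1 / 40, by norm_num, fun p n α K hp hn hα hK ρ hρ φ hφ => ?_⟩
  obtain ⟨M, hM, hMn, hMexp⟩ := exists_block_count hn
  have hK2 : 2 ≤ K := (Real.le_sqrt_of_sq_le (by linarith)).trans hK
  have hL : 1 ≤ Real.log n := by
    rw [Real.le_log_iff_exp_le (by positivity)]
    have : (72 : ℝ) ≤ n := by exact_mod_cast hn
    linarith [Real.exp_one_lt_d9]
  have hΔ : 4 * Real.log n ≤ (⌈4 * Real.log n⌉₊ : ℝ) := Nat.le_ceil _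
  have hΔ0 : 0 < ⌈4 * Real.log n⌉₊ := Nat.ceil_pos.2 (by linarith)
  set Δ := ⌈4 * Real.log n⌉₊
  have hp0 : (0 : ℝ) < p := by exact_mod_cast hp
  have hΔpos : (0 : ℝ) < Δ := by exact_mod_cast hΔ0
  set δ : ℝ := Real.sqrt (1 / 40 * (Real.sqrt (p * Real.log n) + Real.log n) / (p * Δ))
  have hδ : p * δ ^ 2 * Δ = 1 / 40 * (Real.sqrt (p * Real.log n) + Real.log n) := by
    rw [Real.sq_sqrt (by positivity)]
    field_simp
  obtain ⟨hδ2, hcosh⟩ := exp_mul_cosh_pow_le hp hL hΔ hδ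
  have : Nonempty (Fin M) := ⟨⟨0, hM⟩⟩
  exact half_le_risk (by linarith) hK2 hφ
    (blockSignal_mem_ThetaMulti hΔ hΔ0 hMn (hρ.trans hδ.ge)) (abs_blockSignal_le hδ2)
    (sum_prod_blockSignal_le hΔ0 hMn (hcosh.trans hMexp))

end ChangePoint
end
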